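/- Let $1<p_0\le p_1<\infty$, $q_0,q_1\in[1,\infty]$, $s_0>s_1>0$, $\gamma_i\in(-1,p_i-1)$ with $\gamma_0/p_0\ge\gamma_1/p_1$ and $s_0-\frac{1+\gamma_0}{p_0}=s_1-\frac{1+\gamma_1}{p_1}$, and let $m_i>s_i$ be integers. Then for every $f\in F^{s_0}_{p_0,q_0}(I,w_{\gamma_0};X)$ one has the homogeneous Sobolev estimate $[f]^{(m_1)}_{F^{s_1}_{p_1,q_1}(I,w_{\gamma_1};X)}\lesssim [f]^{(m_0)}_{F^{s_0}_{p_0,q_0}(I,w_{\gamma_0};X)}$, where $I\in\{\mathbb{R},\mathbb{R}_+\}$ and $X$ is any Banach space. -/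

import Mathlib

open MeasureTheory Set ENNReal

noncomputable section

variable {X : Type*} [NormedAddCommGroup X] [NormedSpace ℝ X]

/-- The `m`-th order difference `Δ^m_h f(x) = ∑_{j=0}^m (-1)^j binom(m,j) f(x+(m-j)h)`. -/
def mDiff (m : ℕ) (h : ℝ) (f : ℝ → X) (x : ℝ) : X :=
  ∑ j ∈ Finset.range (m + 1), ((-1 : ℝ) ^ j * (m.choose j)) • f (x + ((m : ℝ) - j) * h)

/-- Mean of the `m`-th order difference,
`d^m_t f(x) = t⁻¹ ∫_{V^m_I(x,t)} ‖Δ^m_h f(x)‖ dh`, `V^m_I(x,t) = {|h|<t : x+mh ∈ I}`. -/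
def dMean (I : Set ℝ) (m : ℕ) (t : ℝ) (f : ℝ → X) (x : ℝ) : ℝ≥0∞ :=
  ENNReal.ofReal t⁻¹ *
    ∫⁻ h in {h : ℝ | |h| < t ∧ x + (m : ℝ) * h ∈ I}, (‖mDiff m h f x‖₊ : ℝ≥0∞)

/-- The inner `L^q(dt/t)` norm `(∫_0^∞ (t^{-s} d^m_t f(x))^q dt/t)^{1/q}` (sup if `q=∞`). -/
def innerQ (I : Set ℝ) (s : ℝ) (q : ℝ≥0∞) (m : ℕ) (f : ℝ → X) (x : ℝ) : ℝ≥0∞ :=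
  if q = ⊤ then ⨆ (t : ℝ) (_ : 0 < t), ENNReal.ofReal (t ^ (-s)) * dMean I m t f x
  else (∫⁻ t in Ioi (0:ℝ),
      (ENNReal.ofReal (t ^ (-s)) * dMean I m t f x) ^ q.toReal *
        (ENNReal.ofReal t)⁻¹) ^ (1 / q.toReal)

/-- The difference seminorm `[f]^{(m)}_{F^s_{p,q}(I, w_γ; X)}`, `w_γ(t) = |t|^γ`. -/
def diffSeminorm (I : Set ℝ) (s p γ : ℝ) (q : ℝ≥0∞) (m : ℕ) (f : ℝ → X) : ℝ≥0∞ :=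
  (∫⁻ x in I, ENNReal.ofReal (|x| ^ γ) * (innerQ I s q m f x) ^ p) ^ (1 / p)

/-- The weighted `L^p(I, w_γ; X)` norm, `w_γ(t) = |t|^γ`. -/
def wLpNorm (I : Set ℝ) (p γ : ℝ) (f : ℝ → X) : ℝ≥0∞ :=
  (∫⁻ x in I, ENNReal.ofReal (|x| ^ γ) * (‖f x‖₊ : ℝ≥0∞) ^ p) ^ (1 / p)



def pw (x a : ℝ) : ℝ≥0∞ := ENNReal.ofReal (|x| ^ a)

lemma pw_ne_top (x a : ℝ) : pw x a ≠ ⊤ := ENNReal.ofReal_ne_top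

lemma pw_ne_zero {x : ℝ} (hx : x ≠ 0) (a : ℝ) : pw x a ≠ 0 := by
  have : 0 < |x| ^ a := Real.rpow_pos_of_pos (abs_pos.2 hx) _
  simpa [pw] using this

lemma pw_mul {x : ℝ} (hx : x ≠ 0) (a b : ℝ) : pw x a * pw x b = pw x (a + b) := by
  rw [pw, pw, pw, ← ENNReal.ofReal_mul (by positivity), Real.rpow_add (abs_pos.2 hx)]

lemma pw_rpow {x : ℝ} (hx : x ≠ 0) (a r : ℝ) : (pw x a) ^ r = pw x (a * r) := by
  rw [pw, pw, ENNReal.ofReal_rpow_of_pos (Real.rpow_pos_of_pos (abs_pos.2 hx) _),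
    ← Real.rpow_mul (abs_nonneg _)]

lemma pw_zero (x : ℝ) : pw x 0 = 1 := by simp [pw]

lemma measurable_pw (a : ℝ) : Measurable (fun x => pw x a) := by
  unfold pw; fun_prop

lemma pw_le_of_le {x y a : ℝ} (hxy : |x| ≤ |y|) (ha : 0 ≤ a) : pw x a ≤ pw y a :=
  ENNReal.ofReal_le_ofReal (Real.rpow_le_rpow (abs_nonneg _) hxy ha)

lemma pw_le_of_le_neg {x y a : ℝ} (hx : x ≠ 0) (hxy : |x| ≤ |y|) (ha : a ≤ 0) : pw y a ≤ pw x a :=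
  ENNReal.ofReal_le_ofReal (Real.rpow_le_rpow_of_nonpos (abs_pos.2 hx) hxy ha)

lemma pw_mul_arg (x y a : ℝ) : pw (x * y) a = pw x a * pw y a := by
  rw [pw, pw, pw, ← ENNReal.ofReal_mul (by positivity), abs_mul,
    Real.mul_rpow (abs_nonneg _) (abs_nonneg _)]

/-- comparability: powers of comparable numbers -/
lemma pw_comp {K : ℝ} (hK : 1 ≤ K) (a : ℝ) {x y : ℝ} (hx : x ≠ 0) (hy : y ≠ 0)
    (h1 : |x| ≤ K * |y|) (h2 : |y| ≤ K * |x|) : pw x a ≤ pw K |a| * pw y a := by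
  have hK0 : 0 < K := by linarith
  rcases le_total 0 a with ha | ha
  · rw [abs_of_nonneg ha, ← pw_mul_arg]
    exact pw_le_of_le (by rw [abs_mul, abs_of_pos hK0]; exact h1) ha
  · have : pw x a ≤ pw (K⁻¹ * y) a := by
      refine pw_le_of_le_neg (by positivity) ?_ ha
      rw [abs_mul, abs_of_pos (inv_pos.2 hK0), inv_mul_le_iff₀ hK0]; exact h2
    refine this.trans_eq ?_
    rw [pw_mul_arg]
    congr 1
    rw [pw, pw, abs_of_nonpos ha, abs_inv, Real.inv_rpow (abs_nonneg _), Real.rpow_neg (abs_nonneg _)]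

lemma lint_even (F : ℝ → ℝ≥0∞) : ∫⁻ y, F |y| = 2 * ∫⁻ y in Ioi 0, F y := by
  rw [← lintegral_add_compl _ (measurableSet_Ioi (a := (0:ℝ))), two_mul, compl_Ioi]
  congr 1
  · exact setLIntegral_congr_fun measurableSet_Ioi (fun y hy => by rw [abs_of_pos hy])
  · rw [← setLIntegral_congr (Iio_ae_eq_Iic (a := (0:ℝ)) (μ := volume))]
    have h := (Measure.measurePreserving_neg (volume : Measure ℝ)).setLIntegral_comp_preimage_emb
      (MeasurableEquiv.neg ℝ).measurableEmbedding (fun y => F |y|) (Iio 0)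
    rw [← h]
    have : (Neg.neg ⁻¹' (Iio (0:ℝ))) = Ioi 0 := by ext; simp
    rw [this]
    exact setLIntegral_congr_fun measurableSet_Ioi
      (fun y hy => by rw [abs_neg, abs_of_pos hy])

lemma pw_near {B : ℝ} (hB : -1 < B) : ∃ C : ℝ≥0∞, C ≠ ⊤ ∧ ∀ X : ℝ, 0 < X →
    ∫⁻ y in {y : ℝ | |y| < X}, pw y B ≤ C * pw X (B + 1) := by
  refine ⟨2 * ENNReal.ofReal ((B + 1)⁻¹), by finiteness, fun X hX => ?_⟩
  have hm : MeasurableSet {y : ℝ | |y| < X} := measurableSet_lt (by fun_prop) (by fun_prop)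
  rw [← lintegral_indicator hm]
  have : (fun y => indicator {y : ℝ | |y| < X} (fun y => pw y B) y)
      = fun y => (fun t => indicator (Iio X) (fun t => ENNReal.ofReal (t ^ B)) t) |y| := by
    ext y
    by_cases h : |y| < X <;> simp [indicator, h, pw]
  rw [this, lint_even, lintegral_indicator measurableSet_Iio,
    Measure.restrict_restrict measurableSet_Iio, inter_comm, Ioi_inter_Iio, mul_assoc]
  gcongr
  have hii : IntegrableOn (fun t : ℝ => t ^ B) (Ioo 0 X) := by
    rwa [intervalIntegral.integrableOn_Ioo_rpow_iff hX]
  rw [← ofReal_integral_eq_lintegral_ofReal hii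
    ((ae_restrict_mem measurableSet_Ioo).mono (fun t ht => Real.rpow_nonneg ht.1.le _)), pw,
    ← ENNReal.ofReal_mul (inv_nonneg.2 (by linarith))]
  apply ENNReal.ofReal_le_ofReal
  rw [← integral_Ioc_eq_integral_Ioo, ← intervalIntegral.integral_of_le hX.le,
    integral_rpow (Or.inl hB), Real.zero_rpow (by linarith), abs_of_pos hX]
  apply le_of_eq; field_simp; ring

lemma pw_far {B : ℝ} (hB : B < -1) : ∃ C : ℝ≥0∞, C ≠ ⊤ ∧ ∀ X : ℝ, 0 < X →
    ∫⁻ y in {y : ℝ | X ≤ |y|}, pw y B ≤ C * pw X (B + 1) := by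
  refine ⟨2 * ENNReal.ofReal ((-(B + 1))⁻¹), by finiteness, fun X hX => ?_⟩
  have hm : MeasurableSet {y : ℝ | X ≤ |y|} := measurableSet_le (by fun_prop) (by fun_prop)
  rw [← lintegral_indicator hm]
  have : (fun y => indicator {y : ℝ | X ≤ |y|} (fun y => pw y B) y)
      = fun y => (fun t => indicator (Ici X) (fun t => ENNReal.ofReal (t ^ B)) t) |y| := by
    ext y
    by_cases h : X ≤ |y| <;> simp [indicator, h, pw]
  rw [this, lint_even, lintegral_indicator measurableSet_Ici,
    Measure.restrict_restrict measurableSet_Ici, mul_assoc]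
  have : Ici X ∩ Ioi 0 = Ici X := inter_eq_left.2 (fun t ht => lt_of_lt_of_le hX ht)
  rw [this, ← setLIntegral_congr (Ioi_ae_eq_Ici (a := X) (μ := volume))]
  gcongr
  rw [← ofReal_integral_eq_lintegral_ofReal (integrableOn_Ioi_rpow_of_lt hB hX)
    ((ae_restrict_mem measurableSet_Ioi).mono
      (fun t ht => Real.rpow_nonneg (hX.trans ht).le _)), pw,
    ← ENNReal.ofReal_mul (inv_nonneg.2 (by linarith))]
  apply ENNReal.ofReal_le_ofReal
  rw [integral_Ioi_rpow_of_lt hB hX, abs_of_pos hX]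
  apply le_of_eq
  rw [inv_neg]; field_simp

/-- The Hardy-type kernel integral. -/
lemma pw_max {A B : ℝ} (hB : -1 < B) (hAB : A + B < -1) : ∃ C : ℝ≥0∞, C ≠ ⊤ ∧
    ∀ x : ℝ, x ≠ 0 → ∫⁻ y, pw (max |x| |y|) A * pw y B ≤ C * pw x (A + B + 1) := by
  obtain ⟨C1, h1, H1⟩ := pw_near hB
  obtain ⟨C2, h2, H2⟩ := pw_far hAB
  refine ⟨C1 + C2, by finiteness, fun x hx => ?_⟩
  have hx' : 0 < |x| := abs_pos.2 hx
  have hm : MeasurableSet {y : ℝ | |y| < |x|} := measurableSet_lt (by fun_prop) (by fun_prop)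
  have hm' : MeasurableSet {y : ℝ | |x| ≤ |y|} := measurableSet_le (by fun_prop) (by fun_prop)
  have hc : {y : ℝ | |y| < |x|}ᶜ = {y : ℝ | |x| ≤ |y|} := by ext; simp
  have pa : ∀ a, pw |x| a = pw x a := fun a => by simp [pw]
  rw [← lintegral_add_compl _ hm, hc, add_mul]
  gcongr
  · calc _ = ∫⁻ y in {y : ℝ | |y| < |x|}, pw x A * pw y B :=
          setLIntegral_congr_fun hm (fun y hy => by
            rw [max_eq_left (le_of_lt hy), pa])
      _ = pw x A * ∫⁻ y in {y : ℝ | |y| < |x|}, pw y B := lintegral_const_mul _ (measurable_pw _)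
      _ ≤ pw x A * (C1 * pw |x| (B + 1)) := by gcongr; exact H1 _ hx'
      _ = _ := by rw [pa, mul_left_comm, pw_mul hx, add_assoc]
  · calc _ = ∫⁻ y in {y : ℝ | |x| ≤ |y|}, pw y (A + B) :=
          setLIntegral_congr_fun hm' (fun y hy => by
            have hy0 : y ≠ 0 := abs_pos.1 (hx'.trans_le hy)
            have : pw |y| A = pw y A := by simp [pw]
            rw [max_eq_right hy, this, pw_mul hy0])
      _ ≤ _ := by rw [← pa]; exact H2 _ hx'



lemma schur_test {p p' : ℝ} (hp : p.HolderConjugate p') (K : ℝ → ℝ → ℝ≥0∞)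
    (hK : Measurable (Function.uncurry K)) {φ ψ : ℝ → ℝ≥0∞} (hφ : Measurable φ)
    (hφ0 : ∀ᵐ y, φ y ≠ 0 ∧ φ y ≠ ⊤) (hψ : Measurable ψ) {A B : ℝ≥0∞}
    (h1 : ∀ᵐ x, ∫⁻ y, K x y * φ y ≤ A * ψ x)
    (h2 : ∀ᵐ y, ∫⁻ x, K x y * ψ x ^ (p - 1) ≤ B * φ y ^ (p - 1))
    {u : ℝ → ℝ≥0∞} (hu : Measurable u) :
    ∫⁻ x, (∫⁻ y, K x y * u y) ^ p ≤ A ^ (p - 1) * B * ∫⁻ y, u y ^ p := by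
  have hp1 : 1 < p := hp.lt
  have hp0 : 0 < p := hp.pos
  have hp'0 : 0 < p' := hp.symm.pos
  have hpp : p * (1 / p') = p - 1 := by
    have := hp.inv_add_inv_eq_one
    have h : 1 / p' = 1 - p⁻¹ := by rw [one_div]; linarith
    rw [h]; field_simp
  have hsum : 1 / p' + 1 / p = 1 := by
    have := hp.inv_add_inv_eq_one
    rw [one_div, one_div]; linarith
  have hKx : ∀ x, Measurable (K x) := fun x => hK.comp (measurable_const.prodMk measurable_id)
  have key : ∀ᵐ x, (∫⁻ y, K x y * u y) ^ p
      ≤ A ^ (p - 1) * ∫⁻ y, ψ x ^ (p - 1) * (K x y * (φ y ^ (-(p - 1)) * u y ^ p)) := by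
    filter_upwards [h1] with x hx
    have e1 : ∫⁻ y, K x y * u y = ∫⁻ y, ((fun y => (K x y * φ y) ^ (1 / p')) *
        (fun y => (K x y * (φ y ^ (-(p - 1)) * u y ^ p)) ^ (1 / p))) y := by
      apply lintegral_congr_ae
      filter_upwards [hφ0] with y hy
      simp only [Pi.mul_apply]
      have hi : (0:ℝ) ≤ 1 / p' := by positivity
      have hi2 : (0:ℝ) ≤ 1 / p := by positivity
      rw [ENNReal.mul_rpow_of_nonneg _ _ hi, ENNReal.mul_rpow_of_nonneg _ _ hi2,
        ENNReal.mul_rpow_of_nonneg _ _ hi2, ← ENNReal.rpow_mul, ← ENNReal.rpow_mul,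
        show p * (1 / p) = 1 by field_simp, ENNReal.rpow_one]
      have : -(p - 1) * (1 / p) = -(1 / p') := by
        rw [← hpp]; field_simp
      rw [this]
      calc K x y * u y = (K x y ^ (1 / p') * K x y ^ (1 / p)) * (φ y ^ (1 / p') * φ y ^ (-(1/p'))) * u y := by
            rw [← ENNReal.rpow_add_of_nonneg _ _ hi hi2, hsum, ENNReal.rpow_one,
              ← ENNReal.rpow_add _ _ hy.1 hy.2, add_neg_cancel, ENNReal.rpow_zero, mul_one]
        _ = _ := by ring
    have e2 := ENNReal.lintegral_mul_le_Lp_mul_Lq volume hp.symm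
      (f := fun y => (K x y * φ y) ^ (1 / p'))
      (g := fun y => (K x y * (φ y ^ (-(p - 1)) * u y ^ p)) ^ (1 / p))
      (((hKx x).mul hφ).pow_const _).aemeasurable
      (((hKx x).mul ((hφ.pow_const _).mul (hu.pow_const _))).pow_const _).aemeasurable
    rw [← e1] at e2
    simp only [← ENNReal.rpow_mul] at e2
    rw [show (1 / p') * p' = 1 by field_simp, show (1 / p) * p = 1 by field_simp] at e2
    simp only [ENNReal.rpow_one] at e2
    calc (∫⁻ y, K x y * u y) ^ p
        ≤ ((A * ψ x) ^ (1 / p') * (∫⁻ y, K x y * (φ y ^ (-(p - 1)) * u y ^ p)) ^ (1 / p)) ^ p := by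
          gcongr
          exact e2.trans (by gcongr)
      _ = A ^ (p - 1) * (ψ x ^ (p - 1) * ∫⁻ y, K x y * (φ y ^ (-(p - 1)) * u y ^ p)) := by
          rw [ENNReal.mul_rpow_of_nonneg _ _ hp0.le, ← ENNReal.rpow_mul, ← ENNReal.rpow_mul,
            mul_comm (1 / p') p, hpp, show (1 / p) * p = 1 by field_simp, ENNReal.rpow_one,
            ENNReal.mul_rpow_of_nonneg _ _ (by linarith), mul_assoc]
      _ = _ := by
          congr 1
          exact (lintegral_const_mul _ ((hKx x).mul ((hφ.pow_const _).mul (hu.pow_const _)))).symm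
  have hKm : Measurable (fun z : ℝ × ℝ => K z.1 z.2) := hK
  have hF : Measurable (Function.uncurry fun x y : ℝ =>
      ψ x ^ (p - 1) * (K x y * (φ y ^ (-(p - 1)) * u y ^ p))) := by
    simp only [Function.uncurry_def]
    exact ((hψ.comp measurable_fst).pow_const _).mul
      (hKm.mul (((hφ.comp measurable_snd).pow_const _).mul ((hu.comp measurable_snd).pow_const _)))
  calc ∫⁻ x, (∫⁻ y, K x y * u y) ^ p
      ≤ ∫⁻ x, A ^ (p - 1) * ∫⁻ y, ψ x ^ (p - 1) * (K x y * (φ y ^ (-(p - 1)) * u y ^ p)) :=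
        lintegral_mono_ae key
    _ = A ^ (p - 1) * ∫⁻ x, ∫⁻ y, ψ x ^ (p - 1) * (K x y * (φ y ^ (-(p - 1)) * u y ^ p)) :=
        lintegral_const_mul _ hF.lintegral_prod_right'
    _ = A ^ (p - 1) * ∫⁻ y, ∫⁻ x, ψ x ^ (p - 1) * (K x y * (φ y ^ (-(p - 1)) * u y ^ p)) := by
        rw [lintegral_lintegral_swap hF.aemeasurable]
    _ ≤ A ^ (p - 1) * ∫⁻ y, B * u y ^ p := by
        gcongr 1
        apply lintegral_mono_ae
        filter_upwards [h2, hφ0] with y hy hy0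
        have hKy : Measurable (fun x => K x y) := hKm.comp (measurable_id.prodMk measurable_const)
        calc ∫⁻ x, ψ x ^ (p - 1) * (K x y * (φ y ^ (-(p - 1)) * u y ^ p))
            = ∫⁻ x, (K x y * ψ x ^ (p - 1)) * (φ y ^ (-(p - 1)) * u y ^ p) := by
              congr 1; ext x; ring
          _ = (∫⁻ x, K x y * ψ x ^ (p - 1)) * (φ y ^ (-(p - 1)) * u y ^ p) :=
              lintegral_mul_const _ (hKy.mul (hψ.pow_const _))
          _ ≤ (B * φ y ^ (p - 1)) * (φ y ^ (-(p - 1)) * u y ^ p) := by gcongr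
          _ = B * (φ y ^ (p - 1) * φ y ^ (-(p - 1))) * u y ^ p := by ring
          _ = B * u y ^ p := by
              rw [← ENNReal.rpow_add _ _ hy0.1 hy0.2, add_neg_cancel, ENNReal.rpow_zero, mul_one]
    _ = _ := by rw [lintegral_const_mul _ (hu.pow_const _), mul_assoc]

lemma layer_fin {q : ℝ} (hq : 0 < q) {J : ℝ≥0∞} (hJ : J ≠ ⊤) :
    ∫⁻ l in Ioi (0:ℝ), (if ENNReal.ofReal l < J then ENNReal.ofReal (l ^ (q - 1)) else 0)
      = ENNReal.ofReal q⁻¹ * J ^ q := by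
  lift J to NNReal using hJ
  rcases eq_or_ne J 0 with rfl | hJ0
  · simp [hq]
  have hJp : (0:ℝ) < J := by positivity
  have e : ∀ l ∈ Ioi (0:ℝ), (if ENNReal.ofReal l < (J : ℝ≥0∞) then ENNReal.ofReal (l ^ (q - 1)) else 0)
      = indicator (Iio (J:ℝ)) (fun l => ENNReal.ofReal (l ^ (q - 1))) l := by
    intro l hl
    have : ENNReal.ofReal l < (J : ℝ≥0∞) ↔ l < J := by
      rw [ENNReal.ofReal_lt_coe_iff hl.le]
    simp only [this, indicator, mem_Iio]
  rw [setLIntegral_congr_fun measurableSet_Ioi e, lintegral_indicator measurableSet_Iio,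
    Measure.restrict_restrict measurableSet_Iio, inter_comm, Ioi_inter_Iio]
  have hii : IntegrableOn (fun t : ℝ => t ^ (q - 1)) (Ioo 0 (J:ℝ)) := by
    rw [intervalIntegral.integrableOn_Ioo_rpow_iff hJp]; linarith
  rw [← ofReal_integral_eq_lintegral_ofReal hii
    ((ae_restrict_mem measurableSet_Ioo).mono (fun t ht => Real.rpow_nonneg ht.1.le _)),
    ← integral_Ioc_eq_integral_Ioo, ← intervalIntegral.integral_of_le hJp.le,
    integral_rpow (Or.inl (by linarith)), Real.zero_rpow (by linarith), sub_add_cancel, sub_zero,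
    ← ENNReal.ofReal_coe_nnreal, ENNReal.ofReal_rpow_of_pos hJp,
    ← ENNReal.ofReal_mul (by positivity)]
  congr 1; field_simp

lemma layer_cake {q : ℝ} (hq : 0 < q) (J : ℝ≥0∞) :
    ∫⁻ l in Ioi (0:ℝ), (if ENNReal.ofReal l < J then ENNReal.ofReal (l ^ (q - 1)) else 0)
      = ENNReal.ofReal q⁻¹ * J ^ q := by
  rcases eq_or_ne J ⊤ with rfl | hJ
  swap
  · exact layer_fin hq hJ
  have hq' : ENNReal.ofReal q⁻¹ ≠ 0 := by simpa using hq
  rw [ENNReal.top_rpow_of_pos hq, ENNReal.mul_top hq', eq_top_iff]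
  apply le_of_forall_lt
  intro N hN
  obtain ⟨M, hM⟩ : ∃ M : ℝ≥0∞, M ≠ ⊤ ∧ ENNReal.ofReal q⁻¹ * M ^ q = N + 1 := by
    refine ⟨((ENNReal.ofReal q⁻¹)⁻¹ * (N + 1)) ^ (1 / q), ?_, ?_⟩
    · have : (ENNReal.ofReal q⁻¹)⁻¹ ≠ ⊤ := by simpa using hq
      have h2 : N ≠ ⊤ := hN.ne
      apply ENNReal.rpow_ne_top_of_nonneg (by positivity)
      finiteness
    · rw [← ENNReal.rpow_mul, show 1 / q * q = 1 by field_simp, ENNReal.rpow_one, ← mul_assoc,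
        ENNReal.mul_inv_cancel hq' (by finiteness), one_mul]
  have := layer_fin hq hM.1
  rw [hM.2] at this
  calc N < N + 1 := ENNReal.lt_add_right hN.ne one_ne_zero
    _ = _ := this.symm
    _ ≤ _ := by
      apply lintegral_mono
      intro l
      dsimp only
      split_ifs with h1 h2
      · exact le_rfl
      · exact absurd ENNReal.ofReal_lt_top h2
      · exact zero_le
      · exact le_rfl



lemma pw_rpow_arg {x : ℝ} (hx : 0 < x) (b a : ℝ) : pw (x ^ b) a = pw x (b * a) := by
  rw [pw, pw, abs_of_pos hx, abs_of_pos (Real.rpow_pos_of_pos hx _), ← Real.rpow_mul hx.le]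

lemma hls_weak {p q β : ℝ} (hp : 1 < p) (hpq : p < q) (hβ : β = 1 / p - 1 / q) :
    ∃ D : ℝ≥0∞, D ≠ ⊤ ∧ D ≠ 0 ∧ ∀ u : ℝ → ℝ≥0∞, Measurable u → ∫⁻ y, u y ^ p ≤ 1 →
      ∀ μ : ℝ, 0 < μ → volume {x : ℝ | ENNReal.ofReal μ < D⁻¹ * ∫⁻ y, pw (x - y) (β - 1) * u y}
        ≤ pw μ (-(q / p)) * ∫⁻ y, if ENNReal.ofReal μ < u y ^ (p / q) then u y else 0 := by
  have hp0 : 0 < p := by linarith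
  have hq0 : 0 < q := by linarith
  obtain ⟨p', hpp⟩ : ∃ p', p.HolderConjugate p' := ⟨_, Real.HolderConjugate.conjExponent hp⟩
  have hp' : 1 < p' := hpp.symm.lt
  have hinv : 1 / p' = 1 - 1 / p := by
    have := hpp.inv_add_inv_eq_one
    rw [one_div, one_div]; linarith
  have hqi : 0 < 1 / q := by positivity
  have hpi : 1 / q < 1 / p := one_div_lt_one_div_of_lt hp0 hpq
  have hpi1 : 1 / p < 1 := by rw [div_lt_one hp0]; exact hp
  have hB : (β - 1) * p' < -1 := by
    have : (β - 1) < -(1 / p') := by rw [hinv, hβ]; linarith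
    have h2 := mul_lt_mul_of_pos_right this hpp.symm.pos
    have h3 : -(1 / p') * p' = -1 := by field_simp
    linarith
  obtain ⟨C1, hC1, H1⟩ := pw_far hB
  obtain ⟨C2, hC2, H2⟩ := pw_near (B := β - 1) (by rw [hβ]; linarith)
  set D0 : ℝ≥0∞ := C1 ^ (1 / p') + C2 + 1 with hD0
  have hC1' : C1 ^ (1 / p') ≠ ⊤ := ENNReal.rpow_ne_top_of_nonneg (by positivity) hC1
  have hD0t : D0 ≠ ⊤ := by finiteness
  have hD00 : D0 ≠ 0 := by simp [hD0]
  refine ⟨3 * D0, by finiteness, by simp [hD00], fun u hu hu1 μ hμ => ?_⟩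
  set R : ℝ := μ ^ (-q) with hR
  have hRp : 0 < R := Real.rpow_pos_of_pos hμ _
  set m : ℝ≥0∞ := ENNReal.ofReal μ with hm
  have hm1 : m = pw μ 1 := by rw [hm, pw, Real.rpow_one, abs_of_pos hμ]
  have hm0 : m ≠ 0 := by simpa [hm] using hμ
  have hmt : m ≠ ⊤ := by simp [hm]
  set u1 : ℝ → ℝ≥0∞ := fun y => if m < u y ^ (p / q) then u y else 0 with hu1d
  have hu1m : Measurable u1 :=
    Measurable.ite (measurableSet_lt measurable_const (hu.pow_const _)) hu measurable_const
  set S : Set ℝ := {z | |z| < R} with hS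
  set S' : Set ℝ := {z | R ≤ |z|} with hS'
  have hSm : MeasurableSet S := measurableSet_lt (by fun_prop) (by fun_prop)
  have hS'm : MeasurableSet S' := measurableSet_le (by fun_prop) (by fun_prop)
  set kn : ℝ → ℝ≥0∞ := S.indicator (fun z => pw z (β - 1)) with hkn
  set kf : ℝ → ℝ≥0∞ := S'.indicator (fun z => pw z (β - 1)) with hkf
  have hknm : Measurable kn := (measurable_pw _).indicator hSm
  have hkfm : Measurable kf := (measurable_pw _).indicator hS'm
  have hkk : ∀ z, pw z (β - 1) = kn z + kf z := by
    intro z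
    by_cases h : |z| < R
    · simp [hkn, hkf, hS, hS', h]
    · simp [hkn, hkf, hS, hS', h, not_lt.1 h]
  have hu_split : ∀ y, u y ≤ pw μ (q / p) + u1 y := by
    intro y
    by_cases h : m < u y ^ (p / q)
    · simp [hu1d, h]
    · simp only [hu1d, h, if_false, add_zero]
      have h := ENNReal.rpow_le_rpow (not_lt.1 h) (show 0 ≤ q / p by positivity)
      rw [← ENNReal.rpow_mul, show p / q * (q / p) = 1 by field_simp, ENNReal.rpow_one, hm1,
        pw_rpow hμ.ne', one_mul] at h
      exact h
  have hnear : ∫⁻ z, kn z ≤ D0 * pw R β := by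
    rw [hkn, lintegral_indicator hSm]
    refine (H2 R hRp).trans ?_
    rw [sub_add_cancel]
    gcongr
    exact le_add_right le_add_self
  have hfar : (∫⁻ z, kf z ^ p') ^ (1 / p') ≤ D0 * m := by
    have : ∀ z, kf z ^ p' = S'.indicator (fun z => pw z ((β - 1) * p')) z := by
      intro z
      by_cases h : z ∈ S'
      · have hz : z ≠ 0 := by
          rintro rfl
          have : R ≤ |(0:ℝ)| := h
          simp at this; linarith
        simp only [hkf, indicator_of_mem h, pw_rpow hz]
      · simp only [hkf, indicator_of_notMem h]
        rw [ENNReal.zero_rpow_of_pos (by linarith)]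
    simp only [this]
    rw [lintegral_indicator hS'm]
    calc _ ≤ (C1 * pw R ((β - 1) * p' + 1)) ^ (1 / p') := by
          gcongr; exact H1 R hRp
      _ = C1 ^ (1 / p') * m := by
          rw [ENNReal.mul_rpow_of_nonneg _ _ (by positivity), pw_rpow hRp.ne', hR, pw_rpow_arg hμ, hm1]
          congr 2
          have : ((β - 1) * p' + 1) * (1 / p') = - (1 / q) := by
            have : ((β - 1) * p' + 1) * (1 / p') = β - 1 + 1 / p' := by field_simp
            rw [this, hinv, hβ]; ring
          rw [this]; field_simp
      _ ≤ D0 * m := by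
          gcongr; rw [hD0, add_assoc]; exact le_self_add
  set N1 : ℝ → ℝ≥0∞ := fun x => ∫⁻ y, kn (x - y) * u1 y with hN1
  have hJ : ∀ x, ∫⁻ y, pw (x - y) (β - 1) * u y ≤ 2 * (D0 * m) + N1 x := by
    intro x
    have hknx : Measurable (fun y => kn (x - y)) := hknm.comp (by fun_prop)
    have hkfx : Measurable (fun y => kf (x - y)) := hkfm.comp (by fun_prop)
    have hF : ∫⁻ y, kf (x - y) * u y ≤ D0 * m := by
      have := ENNReal.lintegral_mul_le_Lp_mul_Lq volume hpp.symm (f := fun y => kf (x - y)) (g := u)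
        hkfx.aemeasurable hu.aemeasurable
      simp only [Pi.mul_apply] at this
      refine this.trans ?_
      rw [lintegral_sub_left_eq_self (fun z => kf z ^ p') x]
      calc _ ≤ (D0 * m) * 1 := by
            gcongr
            exact ENNReal.rpow_le_one hu1 (by positivity)
        _ = _ := mul_one _
    have hN : ∫⁻ y, kn (x - y) * pw μ (q / p) ≤ D0 * m := by
      rw [lintegral_mul_const _ hknx, lintegral_sub_left_eq_self (fun z => kn z) x]
      calc _ ≤ D0 * pw R β * pw μ (q / p) := by gcongr
        _ = D0 * m := by
          rw [mul_assoc, hR, pw_rpow_arg hμ, pw_mul hμ.ne', hm1]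
          congr 2
          rw [hβ]; field_simp; ring
    calc ∫⁻ y, pw (x - y) (β - 1) * u y
        ≤ ∫⁻ y, (kf (x - y) * u y + (kn (x - y) * pw μ (q / p) + kn (x - y) * u1 y)) := by
          apply lintegral_mono
          intro y
          dsimp only
          rw [hkk, add_mul, ← mul_add, add_comm]
          gcongr
          exact hu_split y
      _ = (∫⁻ y, kf (x - y) * u y) + ((∫⁻ y, kn (x - y) * pw μ (q / p)) + N1 x) := by
          have m1 : Measurable (fun y => kf (x - y) * u y) := by fun_prop
          have m2 : Measurable (fun y => kn (x - y) * pw μ (q / p)) := by fun_prop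
          rw [lintegral_add_left m1, lintegral_add_left m2]
      _ ≤ D0 * m + (D0 * m + N1 x) := add_le_add hF (add_le_add hN le_rfl)
      _ = _ := by ring
  have hsub : {x : ℝ | m < (3 * D0)⁻¹ * ∫⁻ y, pw (x - y) (β - 1) * u y} ⊆ {x | D0 * m ≤ N1 x} := by
    intro x hx
    change m < _ at hx
    change D0 * m ≤ N1 x
    by_contra hcon
    push Not at hcon
    have h1 : ∫⁻ y, pw (x - y) (β - 1) * u y ≤ 3 * D0 * m := by
      refine (hJ x).trans ?_
      calc _ ≤ 2 * (D0 * m) + D0 * m := by gcongr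
        _ = _ := by ring
    have h3 : (3 * D0) ≠ 0 := by simp [hD00]
    have h4 : (3 * D0) ≠ ⊤ := by finiteness
    have : (3 * D0)⁻¹ * ∫⁻ y, pw (x - y) (β - 1) * u y ≤ m := by
      calc _ ≤ (3 * D0)⁻¹ * (3 * D0 * m) := by gcongr
        _ = m := by rw [← mul_assoc, ENNReal.inv_mul_cancel h3 h4, one_mul]
    exact absurd hx (not_lt.2 this)
  have hFm : Measurable (Function.uncurry fun x y : ℝ => kn (x - y) * u1 y) := by
    simp only [Function.uncurry_def]
    exact (hknm.comp (measurable_fst.sub measurable_snd)).mul (hu1m.comp measurable_snd)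
  have hN1m : Measurable N1 := hFm.lintegral_prod_right'
  have hN1i : ∫⁻ x, N1 x ≤ D0 * pw R β * ∫⁻ y, u1 y := by
    rw [hN1, lintegral_lintegral_swap hFm.aemeasurable]
    have : ∀ y, ∫⁻ x, kn (x - y) * u1 y = (∫⁻ z, kn z) * u1 y := by
      intro y
      have m1 : Measurable (fun x => kn (x - y)) := hknm.comp (by fun_prop)
      rw [lintegral_mul_const _ m1, lintegral_sub_right_eq_self (fun z => kn z) y]
    simp only [this]
    rw [lintegral_const_mul _ hu1m]
    gcongr
  have hDm0 : D0 * m ≠ 0 := mul_ne_zero hD00 hm0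
  have hDmt : D0 * m ≠ ⊤ := by finiteness
  calc _ ≤ volume {x | D0 * m ≤ N1 x} := measure_mono hsub
    _ ≤ (∫⁻ x, N1 x) / (D0 * m) := meas_ge_le_lintegral_div hN1m.aemeasurable hDm0 hDmt
    _ ≤ (D0 * pw R β * ∫⁻ y, u1 y) / (D0 * m) := by gcongr
    _ = (D0 * m * (pw μ (-(q / p)) * ∫⁻ y, u1 y)) / (D0 * m) := by
        congr 1
        rw [← mul_assoc, mul_assoc D0 m, hm1, pw_mul hμ.ne', hR, pw_rpow_arg hμ]
        congr 3
        rw [hβ]; field_simp; ring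
    _ = _ := by rw [mul_comm, ENNReal.mul_div_cancel_right hDm0 hDmt]

lemma hls_one {p q β : ℝ} (hp : 1 < p) (hpq : p < q) (hβ : β = 1 / p - 1 / q) :
    ∃ C : ℝ≥0∞, C ≠ ⊤ ∧ ∀ u : ℝ → ℝ≥0∞, Measurable u → ∫⁻ y, u y ^ p ≤ 1 →
      ∫⁻ x, (∫⁻ y, pw (x - y) (β - 1) * u y) ^ q ≤ C := by
  have hp0 : 0 < p := by linarith
  have hq0 : 0 < q := by linarith
  obtain ⟨D, hDt, hD0, H⟩ := hls_weak hp hpq hβ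
  have hr : 0 < q - q / p := by
    have : q / p < q := div_lt_self hq0 hp
    linarith
  refine ⟨D ^ q * (ENNReal.ofReal q * ENNReal.ofReal (q - q / p)⁻¹),
    ENNReal.mul_ne_top (ENNReal.rpow_ne_top_of_nonneg hq0.le hDt) (by finiteness), fun u hu hu1 => ?_⟩
  set J : ℝ → ℝ≥0∞ := fun x => ∫⁻ y, pw (x - y) (β - 1) * u y with hJ
  have hJm : Measurable J := by
    have : Measurable (Function.uncurry fun x y : ℝ => pw (x - y) (β - 1) * u y) := by
      simp only [Function.uncurry_def]
      exact ((measurable_pw _).comp (measurable_fst.sub measurable_snd)).mul (hu.comp measurable_snd)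
    exact this.lintegral_prod_right'
  have e0 : ∀ x, J x ^ q = D ^ q * (D⁻¹ * J x) ^ q := by
    intro x
    rw [← ENNReal.mul_rpow_of_nonneg _ _ hq0.le, ← mul_assoc, ENNReal.mul_inv_cancel hD0 hDt, one_mul]
  have hqq : ENNReal.ofReal q * ENNReal.ofReal q⁻¹ = 1 := by
    rw [← ENNReal.ofReal_mul hq0.le, mul_inv_cancel₀ hq0.ne', ENNReal.ofReal_one]
  change ∫⁻ x, J x ^ q ≤ _
  simp only [e0]
  have hDJ : Measurable (fun x => D⁻¹ * J x) := hJm.const_mul _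
  rw [lintegral_const_mul _ (hDJ.pow_const _)]
  gcongr
  have e1 : ∀ x, (D⁻¹ * J x) ^ q = ENNReal.ofReal q * ∫⁻ l in Ioi (0:ℝ),
      (if ENNReal.ofReal l < D⁻¹ * J x then ENNReal.ofReal (l ^ (q - 1)) else 0) := by
    intro x
    rw [layer_cake hq0, ← mul_assoc, hqq, one_mul]
  simp only [e1]
  have hGm : Measurable (Function.uncurry fun (x l : ℝ) =>
      (if ENNReal.ofReal l < D⁻¹ * J x then ENNReal.ofReal (l ^ (q - 1)) else 0)) := by
    simp only [Function.uncurry_def]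
    exact Measurable.ite (measurableSet_lt (by fun_prop) (hDJ.comp measurable_fst))
      (by fun_prop) measurable_const
  have hGm2 : Measurable (Function.uncurry fun (l y : ℝ) =>
      (if ENNReal.ofReal l < u y ^ (p / q) then ENNReal.ofReal (l ^ ((q - q / p) - 1)) else 0) * u y) := by
    simp only [Function.uncurry_def]
    exact (Measurable.ite (measurableSet_lt (by fun_prop) ((hu.comp measurable_snd).pow_const _))
      (by fun_prop) measurable_const).mul (hu.comp measurable_snd)
  have hGm3 : Measurable (fun x => ∫⁻ l in Ioi (0:ℝ),
      (if ENNReal.ofReal l < D⁻¹ * J x then ENNReal.ofReal (l ^ (q - 1)) else 0)) :=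
    Measurable.lintegral_prod_right' hGm
  rw [lintegral_const_mul _ hGm3]
  gcongr
  rw [lintegral_lintegral_swap hGm.aemeasurable]
  calc _ ≤ ∫⁻ l in Ioi (0:ℝ), ∫⁻ y,
        (if ENNReal.ofReal l < u y ^ (p / q) then ENNReal.ofReal (l ^ ((q - q / p) - 1)) else 0) * u y := by
        apply setLIntegral_mono' measurableSet_Ioi
        intro l hl
        have hl : 0 < l := hl
        have e2 : ∀ x, (if ENNReal.ofReal l < D⁻¹ * J x then ENNReal.ofReal (l ^ (q - 1)) else 0)
            = {x | ENNReal.ofReal l < D⁻¹ * J x}.indicator (fun _ => ENNReal.ofReal (l ^ (q - 1))) x := by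
          intro x; simp [indicator]
        simp only [e2]
        rw [lintegral_indicator (measurableSet_lt measurable_const hDJ), setLIntegral_const]
        calc _ ≤ ENNReal.ofReal (l ^ (q - 1)) * (pw l (-(q / p)) *
              ∫⁻ y, if ENNReal.ofReal l < u y ^ (p / q) then u y else 0) := by
              gcongr
              exact H u hu hu1 l hl
          _ = ENNReal.ofReal (l ^ ((q - q / p) - 1)) *
              ∫⁻ y, if ENNReal.ofReal l < u y ^ (p / q) then u y else 0 := by
              rw [← mul_assoc]
              congr 1
              have : ∀ a, ENNReal.ofReal (l ^ a) = pw l a := fun a => by rw [pw, abs_of_pos hl]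
              rw [this, this, pw_mul hl.ne']
              congr 1; ring
          _ = _ := by
              rw [← lintegral_const_mul]
              · congr 1; ext y; split_ifs <;> simp
              · exact Measurable.ite (measurableSet_lt measurable_const (hu.pow_const _)) hu measurable_const
    _ = ∫⁻ y, ENNReal.ofReal (q - q / p)⁻¹ * u y ^ p := by
        rw [lintegral_lintegral_swap hGm2.aemeasurable]
        congr 1; ext y
        rw [lintegral_mul_const, layer_cake hr, mul_assoc, ← ENNReal.rpow_mul]
        · congr 1
          have h1 : p / q * (q - q / p) = p - 1 := by field_simp
          rw [h1]
          nth_rewrite 2 [← ENNReal.rpow_one (u y)]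
          rw [← ENNReal.rpow_add_of_nonneg _ _ (by linarith) (by norm_num), sub_add_cancel]
        · exact Measurable.ite (measurableSet_lt (by fun_prop) measurable_const)
            (by fun_prop) measurable_const
    _ = ENNReal.ofReal (q - q / p)⁻¹ * ∫⁻ y, u y ^ p := lintegral_const_mul _ (hu.pow_const _)
    _ ≤ ENNReal.ofReal (q - q / p)⁻¹ * 1 := by gcongr
    _ = _ := mul_one _

/-- Homogeneity: from a bound on the unit ball to a bound for all functions. -/
lemma scale_up {p q : ℝ} (hp : 0 < p) (hq : 0 < q) (K : ℝ → ℝ → ℝ≥0∞)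
    (hK : Measurable (Function.uncurry K)) {C : ℝ≥0∞} (hC0 : C ≠ 0)
    (H : ∀ u : ℝ → ℝ≥0∞, Measurable u → ∫⁻ y, u y ^ p ≤ 1 →
      ∫⁻ x, (∫⁻ y, K x y * u y) ^ q ≤ C) (u : ℝ → ℝ≥0∞) (hu : Measurable u) :
    (∫⁻ x, (∫⁻ y, K x y * u y) ^ q) ^ (1 / q) ≤ C ^ (1 / q) * (∫⁻ y, u y ^ p) ^ (1 / p) := by
  set N := (∫⁻ y, u y ^ p) ^ (1 / p) with hN
  have hNp : N ^ p = ∫⁻ y, u y ^ p := by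
    rw [hN, ← ENNReal.rpow_mul, show 1 / p * p = 1 by field_simp, ENNReal.rpow_one]
  rcases eq_or_ne N 0 with h0 | h0
  · have : ∫⁻ y, u y ^ p = 0 := by rw [← hNp, h0, ENNReal.zero_rpow_of_pos hp]
    rw [lintegral_eq_zero_iff (hu.pow_const _)] at this
    have hz : ∀ x, ∫⁻ y, K x y * u y = 0 := by
      intro x
      have m1 : Measurable (fun y => K x y * u y) :=
        (hK.comp (measurable_const.prodMk measurable_id)).mul hu
      rw [lintegral_eq_zero_iff m1]
      filter_upwards [this] with y hy
      have : u y = 0 := by simpa [ENNReal.rpow_eq_zero_iff, hp, hp.not_gt] using hy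
      simp [this]
    simp only [hz, ENNReal.zero_rpow_of_pos hq, lintegral_zero]
    rw [ENNReal.zero_rpow_of_pos (by positivity)]
    exact zero_le
  rcases eq_or_ne N ⊤ with ht | ht
  · rw [ht, ENNReal.mul_top]
    · exact le_top
    · simp [ENNReal.rpow_eq_zero_iff, hC0, hq.le]
  have hKx : ∀ x, Measurable (K x) := fun x => hK.comp (measurable_const.prodMk measurable_id)
  have h1 := H (fun y => N⁻¹ * u y) (hu.const_mul _) (by
    simp only [ENNReal.mul_rpow_of_nonneg _ _ hp.le]
    rw [lintegral_const_mul _ (hu.pow_const _), ← hNp, ← ENNReal.mul_rpow_of_nonneg _ _ hp.le,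
      ENNReal.inv_mul_cancel h0 ht, ENNReal.one_rpow])
  have h2 : ∀ x, ∫⁻ y, K x y * u y = N * ∫⁻ y, K x y * (N⁻¹ * u y) := by
    intro x
    have m1 : Measurable (fun y => K x y * (N⁻¹ * u y)) := (hKx x).mul (hu.const_mul _)
    rw [← lintegral_const_mul _ m1]
    congr 1; ext y
    rw [show N * (K x y * (N⁻¹ * u y)) = (N * N⁻¹) * (K x y * u y) by ring,
      ENNReal.mul_inv_cancel h0 ht, one_mul]
  have hm : Measurable (fun x => ∫⁻ y, K x y * (N⁻¹ * u y)) := by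
    have hKm : Measurable (fun z : ℝ × ℝ => K z.1 z.2) := hK
    have : Measurable (Function.uncurry fun x y : ℝ => K x y * (N⁻¹ * u y)) := by
      simp only [Function.uncurry_def]
      exact hKm.mul ((hu.comp measurable_snd).const_mul _)
    exact this.lintegral_prod_right'
  simp only [h2, ENNReal.mul_rpow_of_nonneg _ _ hq.le]
  rw [lintegral_const_mul _ (hm.pow_const _)]
  calc _ ≤ (N ^ q * C) ^ (1 / q) := by gcongr
    _ = _ := by
      rw [ENNReal.mul_rpow_of_nonneg _ _ (by positivity), ← ENNReal.rpow_mul,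
        show q * (1 / q) = 1 by field_simp, ENNReal.rpow_one, mul_comm]



lemma ae_ne (x : ℝ) : ∀ᵐ y : ℝ, y ≠ x := by
  simp [ae_iff]

lemma measurable_max_kernel {a b c : ℝ} : Measurable (Function.uncurry fun x y : ℝ =>
    pw x a * pw (max |x| |y|) b * pw y c) := by
  simp only [Function.uncurry_def]
  have h1 : Measurable (fun z : ℝ × ℝ => pw z.1 a) := (measurable_pw a).comp measurable_fst
  have h2 : Measurable (fun z : ℝ × ℝ => pw z.2 c) := (measurable_pw c).comp measurable_snd
  have h3 : Measurable (fun z : ℝ × ℝ => pw (max |z.1| |z.2|) b) :=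
    (measurable_pw b).comp (by fun_prop)
  exact (h1.mul h3).mul h2

lemma pw_max_ne {x : ℝ} (hx : x ≠ 0) (y : ℝ) : max |x| |y| ≠ 0 :=
  (lt_of_lt_of_le (abs_pos.2 hx) (le_max_left _ _)).ne'

set_option maxHeartbeats 2000000 in
lemma sw_far {p q a c α β : ℝ} (hp : 1 < p) (hpq : p ≤ q) (ha : a < 1 - 1 / p)
    (hc : -(1 / q) < c) (hβ : β = 1 / p - 1 / q) (hα : α = β + a - c) :
    ∃ C : ℝ≥0∞, C ≠ ⊤ ∧ ∀ u : ℝ → ℝ≥0∞, Measurable u → ∫⁻ y, u y ^ p ≤ 1 →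
      ∫⁻ x, (∫⁻ y, (pw x c * pw (max |x| |y|) (α - 1) * pw y (-a)) * u y) ^ q ≤ C := by
  have hp0 : 0 < p := by linarith
  have hq0 : 0 < q := by linarith
  obtain ⟨p', hpp⟩ : ∃ p', p.HolderConjugate p' := ⟨_, Real.HolderConjugate.conjExponent hp⟩
  have hp'0 : 0 < p' := hpp.symm.pos
  have hinv : 1 / p' = 1 - 1 / p := by
    have := hpp.inv_add_inv_eq_one
    rw [one_div, one_div]; linarith
  have hpip : 1 / p * p = 1 := by field_simp
  have hqiq : 1 / q * q = 1 := by field_simp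
  have hp'i : 1 / p' * p' = 1 := by field_simp
  have hpi0 : 0 < 1 / p := by positivity
  -- Hölder constant
  obtain ⟨C1, hC1, H1⟩ := pw_max (A := (α - 1) * p') (B := (-a) * p')
    (by nlinarith) (by
      have : α - 1 - a < -(1 / p') := by rw [hinv, hα, hβ]; linarith
      nlinarith)
  obtain ⟨C2, hC2, H2⟩ := pw_max (A := α - 1) (B := -a - 1 / p) (by linarith)
    (by rw [hα, hβ]; linarith)
  obtain ⟨C3, hC3, H3⟩ := pw_max (A := α - 1) (B := c - β - (p - 1) / p)
    (by
      have : (p - 1) / p = 1 - 1 / p := by field_simp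
      rw [this, hβ]; linarith)
    (by
      have : (p - 1) / p = 1 - 1 / p := by field_simp
      rw [this, hα]; linarith)
  set C1' := C1 ^ (1 / p') with hC1'
  have hC1't : C1' ≠ ⊤ := ENNReal.rpow_ne_top_of_nonneg (by positivity) hC1
  refine ⟨C1' ^ (q - p) * (C2 ^ (p - 1) * C3), ?_, fun u hu hu1 => ?_⟩
  · have h1 : C1' ^ (q - p) ≠ ⊤ := ENNReal.rpow_ne_top_of_nonneg (by linarith) hC1't
    have h2 : C2 ^ (p - 1) ≠ ⊤ := ENNReal.rpow_ne_top_of_nonneg (by linarith) hC2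
    finiteness
  set Hu : ℝ → ℝ≥0∞ := fun x => ∫⁻ y, (pw x c * pw (max |x| |y|) (α - 1) * pw y (-a)) * u y with hHu
  have hkm : ∀ x a' b' c', Measurable (fun y => pw x a' * pw (max |x| |y|) b' * pw y c') :=
    fun x a' b' c' => measurable_max_kernel.comp (measurable_const.prodMk measurable_id)
  have hmm : ∀ x b', Measurable (fun y : ℝ => pw (max |x| |y|) b') := fun x b' =>
    (measurable_pw b').comp (by fun_prop)
  have hyy : ∀ c', Measurable (fun y : ℝ => pw y c') := measurable_pw
  have hmy : ∀ x b' c', Measurable (fun y : ℝ => pw (max |x| |y|) b' * pw y c') := fun x b' c' =>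
    (hmm x b').mul (hyy c')
  have hold : ∀ x, x ≠ 0 → Hu x ≤ C1' * pw x (-(1 / q)) := by
    intro x hx
    have := ENNReal.lintegral_mul_le_Lp_mul_Lq volume hpp.symm
      (f := fun y => pw x c * pw (max |x| |y|) (α - 1) * pw y (-a)) (g := u)
      (hkm x _ _ _).aemeasurable hu.aemeasurable
    simp only [Pi.mul_apply] at this
    refine this.trans ?_
    have e1 : ∫⁻ y, (pw x c * pw (max |x| |y|) (α - 1) * pw y (-a)) ^ p'
        ≤ pw x (c * p') * (C1 * pw x ((α - 1) * p' + (-a) * p' + 1)) := by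
      have : ∫⁻ y, (pw x c * pw (max |x| |y|) (α - 1) * pw y (-a)) ^ p'
          = ∫⁻ y, pw x (c * p') * (pw (max |x| |y|) ((α - 1) * p') * pw y ((-a) * p')) := by
        apply lintegral_congr_ae
        filter_upwards [ae_ne 0] with y hy
        rw [ENNReal.mul_rpow_of_nonneg _ _ hp'0.le, ENNReal.mul_rpow_of_nonneg _ _ hp'0.le,
          pw_rpow hx, pw_rpow (pw_max_ne hx y), pw_rpow hy, mul_assoc]
      rw [this, lintegral_const_mul _ (hmy x _ _)]
      gcongr
      exact H1 x hx
    calc _ ≤ (pw x (c * p') * (C1 * pw x ((α - 1) * p' + (-a) * p' + 1))) ^ (1 / p') * 1 := by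
          gcongr
          exact ENNReal.rpow_le_one hu1 (by positivity)
      _ = C1' * pw x (-(1 / q)) := by
          rw [mul_one, mul_left_comm, pw_mul hx, ENNReal.mul_rpow_of_nonneg _ _ (by positivity),
            pw_rpow hx, ← hC1']
          congr 2
          have : (c * p' + ((α - 1) * p' + -a * p' + 1)) * (1 / p') = c + α - 1 - a + 1 / p' := by
            field_simp; ring
          rw [this, hinv, hα, hβ]; ring
  have step : ∀ᵐ x, Hu x ^ q ≤ C1' ^ (q - p) *
      (∫⁻ y, (pw x (c - β) * pw (max |x| |y|) (α - 1) * pw y (-a)) * u y) ^ p := by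
    filter_upwards [ae_ne 0] with x hx
    have e2 : ∫⁻ y, (pw x (c - β) * pw (max |x| |y|) (α - 1) * pw y (-a)) * u y
        = pw x (-β) * Hu x := by
      rw [hHu]
      have m1 : Measurable (fun y => (pw x c * pw (max |x| |y|) (α - 1) * pw y (-a)) * u y) :=
        (hkm x _ _ _).mul hu
      beta_reduce
      rw [← lintegral_const_mul _ m1]
      congr 1; ext y
      rw [sub_eq_neg_add, ← pw_mul hx]; ring
    rw [e2]
    calc Hu x ^ q = Hu x ^ (q - p) * Hu x ^ p := by
          rw [← ENNReal.rpow_add_of_nonneg _ _ (by linarith) hp0.le, sub_add_cancel]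
      _ ≤ (C1' * pw x (-(1 / q))) ^ (q - p) * Hu x ^ p := by
          have hqp : 0 ≤ q - p := by linarith
          gcongr
          exact hold x hx
      _ = _ := by
          rw [ENNReal.mul_rpow_of_nonneg _ _ (by linarith), pw_rpow hx,
            ENNReal.mul_rpow_of_nonneg _ _ hp0.le, pw_rpow hx, mul_assoc]
          congr 3
          rw [hβ]; field_simp
  have hsch := schur_test hpp (fun x y => pw x (c - β) * pw (max |x| |y|) (α - 1) * pw y (-a))
    measurable_max_kernel (φ := fun y => pw y (-(1 / p))) (ψ := fun y => pw y (-(1 / p)))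
    (measurable_pw _)
    (by filter_upwards [ae_ne 0] with y hy using ⟨pw_ne_zero hy _, pw_ne_top _ _⟩)
    (measurable_pw _) (A := C2) (B := C3) (by
      filter_upwards [ae_ne 0] with x hx
      have : ∫⁻ y, pw x (c - β) * pw (max |x| |y|) (α - 1) * pw y (-a) * pw y (-(1 / p))
          = ∫⁻ y, pw x (c - β) * (pw (max |x| |y|) (α - 1) * pw y (-a - 1 / p)) := by
        apply lintegral_congr_ae
        filter_upwards [ae_ne 0] with y hy
        rw [sub_eq_add_neg (-a), ← pw_mul hy]; ring
      rw [this, lintegral_const_mul _ (hmy x _ _)]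
      calc _ ≤ pw x (c - β) * (C2 * pw x (α - 1 + (-a - 1 / p) + 1)) := by gcongr; exact H2 x hx
        _ = _ := by
          rw [mul_left_comm, pw_mul hx]; congr 2; rw [hα]; ring) (by
      filter_upwards [ae_ne 0] with y hy
      have : ∫⁻ x, pw x (c - β) * pw (max |x| |y|) (α - 1) * pw y (-a) * pw x (-(1 / p)) ^ (p - 1)
          = ∫⁻ x, pw y (-a) * (pw (max |y| |x|) (α - 1) * pw x (c - β - (p - 1) / p)) := by
        apply lintegral_congr_ae
        filter_upwards [ae_ne 0] with x hx
        rw [pw_rpow hx, show c - β - (p - 1) / p = c - β + (-(1 / p) * (p - 1)) by field_simp; ring,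
          ← pw_mul hx, max_comm |y|]; ring
      rw [this, lintegral_const_mul _ (hmy y _ _)]
      calc _ ≤ pw y (-a) * (C3 * pw y (α - 1 + (c - β - (p - 1) / p) + 1)) := by
            gcongr; exact H3 y hy
        _ = _ := by
          rw [mul_left_comm, pw_mul hy, pw_rpow hy]; congr 2; rw [hα]; field_simp; ring) hu
  calc ∫⁻ x, Hu x ^ q ≤ _ := lintegral_mono_ae step
    _ = C1' ^ (q - p) * ∫⁻ x,
      (∫⁻ y, (pw x (c - β) * pw (max |x| |y|) (α - 1) * pw y (-a)) * u y) ^ p := by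
        have m1 : Measurable (Function.uncurry fun x y =>
            (pw x (c - β) * pw (max |x| |y|) (α - 1) * pw y (-a)) * u y) :=
          measurable_max_kernel.mul (hu.comp measurable_snd)
        have m2 : Measurable (fun x =>
            ∫⁻ y, (pw x (c - β) * pw (max |x| |y|) (α - 1) * pw y (-a)) * u y) :=
          m1.lintegral_prod_right'
        rw [lintegral_const_mul _ (m2.pow_const _)]
    _ ≤ C1' ^ (q - p) * (C2 ^ (p - 1) * C3 * 1) := by
        gcongr
        exact hsch.trans (by gcongr)
    _ = _ := by rw [mul_one]

def nearK (a c α : ℝ) (x y : ℝ) : ℝ≥0∞ :=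
  if |x - y| < |x| / 2 then pw x (c - a) * pw (x - y) (α - 1) else 0

lemma measurable_nearK (a c α : ℝ) : Measurable (Function.uncurry (nearK a c α)) := by
  have h1 : Measurable (fun z : ℝ × ℝ => pw z.1 (c - a)) := (measurable_pw _).comp measurable_fst
  have h2 : Measurable (fun z : ℝ × ℝ => pw (z.1 - z.2) (α - 1)) :=
    (measurable_pw _).comp (measurable_fst.sub measurable_snd)
  simp only [Function.uncurry_def, nearK]
  exact Measurable.ite (measurableSet_lt (by fun_prop) (by fun_prop)) (h1.mul h2) measurable_const

lemma sw_near {p q a c α β : ℝ} (hp : 1 < p) (hpq : p ≤ q) (hca : c ≤ a)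
    (hβ : β = 1 / p - 1 / q) (hα : α = β + a - c) (hα0 : 0 < α) :
    ∃ C : ℝ≥0∞, C ≠ ⊤ ∧ ∀ u : ℝ → ℝ≥0∞, Measurable u → ∫⁻ y, u y ^ p ≤ 1 →
      ∫⁻ x, (∫⁻ y, nearK a c α x y * u y) ^ q ≤ C := by
  rcases hpq.lt_or_eq with hlt | rfl
  · obtain ⟨C, hC, H⟩ := hls_one hp hlt hβ
    refine ⟨C, hC, fun u hu hu1 => le_trans (lintegral_mono fun x => ?_) (H u hu hu1)⟩
    have hq0 : 0 ≤ q := by linarith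
    dsimp only
    gcongr 1
    apply lintegral_mono_ae
    filter_upwards [ae_ne x] with y hy
    gcongr
    have hxy : x - y ≠ 0 := sub_ne_zero.2 hy.symm
    rw [nearK]
    split_ifs with h
    · calc _ ≤ pw (x - y) (c - a) * pw (x - y) (α - 1) := by
            gcongr
            refine pw_le_of_le_neg hxy ?_ (by linarith)
            have := abs_nonneg x
            linarith
        _ = _ := by rw [pw_mul hxy]; congr 1; rw [hα]; ring
    · exact zero_le
  · have hα' : α = a - c := by rw [hα, hβ]; ring
    obtain ⟨p', hpp⟩ : ∃ p', p.HolderConjugate p' := ⟨_, Real.HolderConjugate.conjExponent hp⟩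
    obtain ⟨C, hC, H⟩ := pw_near (B := α - 1) (by linarith)
    have hcat : c - a = -α := by rw [hα']; ring
    refine ⟨(C * pw (1/2) α) ^ (p - 1) * (C * pw (2/3) (-α)), ?_, fun u hu hu1 => ?_⟩
    · have := pw_ne_top (1/2) α
      have h2 := pw_ne_top (2/3) (-α)
      have : (C * pw (1/2) α) ^ (p - 1) ≠ ⊤ :=
        ENNReal.rpow_ne_top_of_nonneg (by linarith) (by finiteness)
      finiteness
    have := schur_test hpp (nearK a c α) (measurable_nearK a c α) (φ := fun _ => 1) (ψ := fun _ => 1)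
      measurable_const (by simp) measurable_const (A := C * pw (1/2) α) (B := C * pw (2/3) (-α)) (by
        filter_upwards [ae_ne 0] with x hx
        have hm : MeasurableSet {z : ℝ | |z| < |x| / 2} := measurableSet_lt (by fun_prop) (by fun_prop)
        have e : ∀ y, nearK a c α x y * 1 = pw x (-α) *
            (fun z => {z : ℝ | |z| < |x| / 2}.indicator (fun z => pw z (α - 1)) z) (x - y) := by
          intro y
          rw [nearK, hcat]
          by_cases h : |x - y| < |x| / 2 <;> simp [indicator, h]
        simp only [e]
        rw [lintegral_sub_left_eq_self (fun z => pw x (-α) *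
          (fun z => {z : ℝ | |z| < |x| / 2}.indicator (fun z => pw z (α - 1)) z) z) x,
          lintegral_const_mul _ ((measurable_pw _).indicator hm), lintegral_indicator hm, mul_one]
        calc _ ≤ pw x (-α) * (C * pw (|x| / 2) (α - 1 + 1)) := by
              gcongr; exact H _ (by positivity)
          _ = _ := by
              rw [sub_add_cancel, show |x| / 2 = |x| * (1 / 2) by ring, pw_mul_arg,
                show pw |x| α = pw x α by simp [pw]]
              rw [show pw x (-α) * (C * (pw x α * pw (1/2) α)) = C * pw (1/2) α * (pw x (-α) * pw x α) by ring,
                pw_mul hx, neg_add_cancel, pw_zero, mul_one]) (by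
        filter_upwards [ae_ne 0] with y hy
        have hm : MeasurableSet {z : ℝ | |z| < |y|} := measurableSet_lt (by fun_prop) (by fun_prop)
        have e : ∀ x, nearK a c α x y * 1 ^ (p - 1) ≤ pw (2/3 * y) (-α) *
            (fun z => {z : ℝ | |z| < |y|}.indicator (fun z => pw z (α - 1)) z) (x - y) := by
          intro x
          rw [nearK, hcat, ENNReal.one_rpow, mul_one]
          split_ifs with h
          · have h1 : |x| ≤ |x - y| + |y| := by
              have := abs_add_le (x - y) y; simpa using this
            have h2 : |y| ≤ |x - y| + |x| := by
              have := abs_sub x (x - y)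
              rw [_root_.sub_sub_cancel] at this; linarith
            have h3 : |x - y| < |y| := by linarith
            simp only [indicator, mem_ofPred_eq, h3, if_true]
            gcongr
            refine pw_le_of_le_neg (by positivity) ?_ (by linarith)
            rw [abs_mul, abs_of_pos (by norm_num : (0:ℝ) < 2 / 3)]
            linarith
          · exact zero_le
        refine (lintegral_mono e).trans ?_
        rw [lintegral_sub_right_eq_self (fun z => pw (2/3 * y) (-α) *
          (fun z => {z : ℝ | |z| < |y|}.indicator (fun z => pw z (α - 1)) z) z) y,
          lintegral_const_mul _ ((measurable_pw _).indicator hm), lintegral_indicator hm,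
          ENNReal.one_rpow, mul_one]
        calc _ ≤ pw (2/3 * y) (-α) * (C * pw |y| (α - 1 + 1)) := by
              gcongr; exact H _ (by positivity)
          _ = _ := by
              rw [sub_add_cancel, pw_mul_arg, show pw |y| α = pw y α by simp [pw]]
              rw [show pw (2/3) (-α) * pw y (-α) * (C * pw y α)
                = C * pw (2/3) (-α) * (pw y (-α) * pw y α) by ring,
                pw_mul hy, neg_add_cancel, pw_zero, mul_one]) hu
    calc _ ≤ _ := this
      _ ≤ (C * pw (1/2) α) ^ (p - 1) * (C * pw (2/3) (-α)) * 1 := by gcongr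
      _ = _ := mul_one _

theorem stein_weiss {p q a c α : ℝ} (hp : 1 < p) (hpq : p ≤ q) (ha : a < 1 - 1 / p)
    (hc : -(1 / q) < c) (hca : c ≤ a) (hα : α = 1 / p - 1 / q + a - c) (hα0 : 0 < α) :
    ∃ C : ℝ≥0∞, C ≠ ⊤ ∧ ∀ u : ℝ → ℝ≥0∞, Measurable u →
      (∫⁻ x, (∫⁻ y, (pw x c * pw (x - y) (α - 1) * pw y (-a)) * u y) ^ q) ^ (1 / q)
        ≤ C * (∫⁻ y, u y ^ p) ^ (1 / p) := by
  have hq1 : 1 ≤ q := by linarith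
  have hq0 : 0 < q := by linarith
  have hα1 : α - 1 ≤ 0 := by rw [hα]; linarith
  obtain ⟨C1, hC1, H1⟩ := sw_far hp hpq ha hc rfl hα
  obtain ⟨C2, hC2, H2⟩ := sw_near hp hpq hca rfl hα hα0
  set D : ℝ≥0∞ := pw (3⁻¹) (α - 1) + pw 2 |-a| with hD
  have hDt : D ≠ ⊤ := ENNReal.add_ne_top.2 ⟨pw_ne_top _ _, pw_ne_top _ _⟩
  set C : ℝ≥0∞ := D ^ q * (2 ^ (q - 1) * (C1 + C2)) + 1 with hC
  have hCt : C ≠ ⊤ := by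
    have h1 : D ^ q ≠ ⊤ := ENNReal.rpow_ne_top_of_nonneg hq0.le hDt
    have h2 : (2:ℝ≥0∞) ^ (q - 1) ≠ ⊤ := ENNReal.rpow_ne_top_of_nonneg (by linarith) (by simp)
    finiteness
  have hkm : Measurable (Function.uncurry fun x y : ℝ => pw x c * pw (x - y) (α - 1) * pw y (-a)) := by
    simp only [Function.uncurry_def]
    have h1 : Measurable (fun z : ℝ × ℝ => pw z.1 c) := (measurable_pw _).comp measurable_fst
    have h2 : Measurable (fun z : ℝ × ℝ => pw z.2 (-a)) := (measurable_pw _).comp measurable_snd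
    have h3 : Measurable (fun z : ℝ × ℝ => pw (z.1 - z.2) (α - 1)) :=
      (measurable_pw _).comp (by fun_prop)
    exact (h1.mul h3).mul h2
  refine ⟨C ^ (1 / q), ENNReal.rpow_ne_top_of_nonneg (by positivity) hCt, fun u hu => ?_⟩
  refine scale_up (by linarith) hq0 _ hkm (by simp [hC]) (fun u hu hu1 => ?_) u hu
  have key : ∀ᵐ x, (∫⁻ y, (pw x c * pw (x - y) (α - 1) * pw y (-a)) * u y) ^ q
      ≤ D ^ q * (2 ^ (q - 1) *
        ((∫⁻ y, (pw x c * pw (max |x| |y|) (α - 1) * pw y (-a)) * u y) ^ q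
        + (∫⁻ y, nearK a c α x y * u y) ^ q)) := by
    filter_upwards [ae_ne 0] with x hx
    have mF : Measurable (fun y => (pw x c * pw (max |x| |y|) (α - 1) * pw y (-a)) * u y) :=
      (measurable_max_kernel.comp (measurable_const.prodMk measurable_id)).mul hu
    have mN : Measurable (fun y => nearK a c α x y * u y) :=
      ((measurable_nearK a c α).comp (measurable_const.prodMk measurable_id)).mul hu
    have : ∫⁻ y, (pw x c * pw (x - y) (α - 1) * pw y (-a)) * u y
        ≤ D * ((∫⁻ y, (pw x c * pw (max |x| |y|) (α - 1) * pw y (-a)) * u y)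
          + ∫⁻ y, nearK a c α x y * u y) := by
      have mFN : Measurable (fun y => (pw x c * pw (max |x| |y|) (α - 1) * pw y (-a)) * u y
          + nearK a c α x y * u y) := mF.add mN
      rw [← lintegral_add_left mF, ← lintegral_const_mul _ mFN]
      apply lintegral_mono_ae
      filter_upwards [ae_ne 0, ae_ne x] with y hy hxy
      have hxy' : x - y ≠ 0 := sub_ne_zero.2 hxy.symm
      suffices hs : pw x c * pw (x - y) (α - 1) * pw y (-a) ≤
          D * (pw x c * pw (max |x| |y|) (α - 1) * pw y (-a) + nearK a c α x y) by
        rw [← add_mul, ← mul_assoc D]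
        exact mul_le_mul' hs le_rfl
      have h1 : |x| ≤ |x - y| + |y| := by
        have := abs_add_le (x - y) y; simpa using this
      have h2 : |y| ≤ |x - y| + |x| := by
        have := abs_sub x (x - y)
        rw [_root_.sub_sub_cancel] at this; linarith
      by_cases h : |x - y| < |x| / 2
      · calc _ ≤ pw x c * pw (x - y) (α - 1) * (pw 2 |-a| * pw x (-a)) := by
              have := pw_comp (K := 2) (by norm_num) (-a) hy hx (by linarith) (by linarith)
              exact mul_le_mul' le_rfl this
          _ = pw 2 |-a| * nearK a c α x y := by
              rw [nearK, if_pos h, sub_eq_add_neg c a, ← pw_mul hx]; ring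
          _ ≤ _ := by
              exact mul_le_mul' le_add_self le_add_self
      · have h := not_lt.1 h
        have hx' := abs_nonneg x
        calc _ ≤ pw x c * (pw 3⁻¹ (α - 1) * pw (max |x| |y|) (α - 1)) * pw y (-a) := by
              gcongr
              rw [← pw_mul_arg]
              refine pw_le_of_le_neg (mul_ne_zero (by norm_num) (pw_max_ne hx y)) ?_ hα1
              rw [abs_mul, abs_of_pos (by norm_num : (0:ℝ) < 3⁻¹),
                abs_of_nonneg (le_trans hx' (le_max_left _ _)), inv_mul_le_iff₀ (by norm_num)]
              exact max_le (by linarith) (by linarith)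
          _ = pw 3⁻¹ (α - 1) * (pw x c * pw (max |x| |y|) (α - 1) * pw y (-a)) := by ring
          _ ≤ _ := by
              exact mul_le_mul' le_self_add le_self_add
    calc _ ≤ (D * ((∫⁻ y, (pw x c * pw (max |x| |y|) (α - 1) * pw y (-a)) * u y)
          + ∫⁻ y, nearK a c α x y * u y)) ^ q := by gcongr
      _ ≤ _ := by
        rw [ENNReal.mul_rpow_of_nonneg _ _ hq0.le]
        gcongr
        exact ENNReal.rpow_add_le_mul_rpow_add_rpow _ _ hq1
  have mF : Measurable (fun x => ∫⁻ y, (pw x c * pw (max |x| |y|) (α - 1) * pw y (-a)) * u y) := by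
    have : Measurable (Function.uncurry fun x y =>
        (pw x c * pw (max |x| |y|) (α - 1) * pw y (-a)) * u y) :=
      measurable_max_kernel.mul (hu.comp measurable_snd)
    exact this.lintegral_prod_right'
  have mN : Measurable (fun x => ∫⁻ y, nearK a c α x y * u y) := by
    have : Measurable (Function.uncurry fun x y => nearK a c α x y * u y) :=
      (measurable_nearK a c α).mul (hu.comp measurable_snd)
    exact this.lintegral_prod_right'
  refine (lintegral_mono_ae key).trans ?_
  have m3 : Measurable (fun x =>
      (∫⁻ y, (pw x c * pw (max |x| |y|) (α - 1) * pw y (-a)) * u y) ^ q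
        + (∫⁻ y, nearK a c α x y * u y) ^ q) := (mF.pow_const _).add (mN.pow_const _)
  have m4 : Measurable (fun x => (2:ℝ≥0∞) ^ (q - 1) *
      ((∫⁻ y, (pw x c * pw (max |x| |y|) (α - 1) * pw y (-a)) * u y) ^ q
        + (∫⁻ y, nearK a c α x y * u y) ^ q)) := m3.const_mul _
  rw [lintegral_const_mul _ m4, lintegral_const_mul _ m3,
    lintegral_add_left (mF.pow_const _)]
  refine le_trans ?_ (le_self_add : D ^ q * (2 ^ (q - 1) * (C1 + C2)) ≤ C)
  gcongr
  · exact H1 u hu hu1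
  · exact H2 u hu hu1



lemma mDiff_eq_iter {X : Type*} [NormedAddCommGroup X] [NormedSpace ℝ X] (m : ℕ) (h : ℝ) (f : ℝ → X) :
    mDiff m h f = (fwdDiff h)^[m] f := by
  ext x
  rw [fwdDiff_iter_eq_sum_shift, mDiff, ← Finset.sum_range_reflect]
  refine Finset.sum_congr rfl fun j hj => ?_
  have hj' : j ≤ m := Nat.lt_succ_iff.1 (Finset.mem_range.1 hj)
  have e : m + 1 - 1 - j = m - j := by omega
  rw [e, Nat.choose_symm hj', Nat.cast_sub hj', ← Int.cast_smul_eq_zsmul ℝ]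
  push_cast
  congr 2
  rw [nsmul_eq_mul]; ring

lemma mDiff_succ {X : Type*} [NormedAddCommGroup X] [NormedSpace ℝ X] (m : ℕ) (h : ℝ) (f : ℝ → X) (x : ℝ) :
    mDiff (m + 1) h f x = mDiff m h f (x + h) - mDiff m h f x := by
  rw [mDiff_eq_iter, mDiff_eq_iter, Function.iterate_succ_apply']
  rfl

lemma mDiff_zero {X : Type*} [NormedAddCommGroup X] [NormedSpace ℝ X] (h : ℝ) (f : ℝ → X) (x : ℝ) :
    mDiff 0 h f x = f x := by
  simp [mDiff]

lemma mDiff_hasDeriv {K : ℝ → ℝ} (hK : Differentiable ℝ K) (m : ℕ) (h v : ℝ) :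
    HasDerivAt (fun v => mDiff m h K v) (mDiff m h (deriv K) v) v := by
  induction m generalizing v with
  | zero => simpa only [mDiff_zero] using (hK v).hasDerivAt
  | succ m ih =>
    simp only [mDiff_succ]
    exact ((ih (v + h)).comp_add_const v h).sub (ih v)

lemma mDiff_smooth (m : ℕ) : ∀ {K : ℝ → ℝ}, ContDiff ℝ ((⊤ : ℕ∞) : WithTop ℕ∞) K → HasCompactSupport K →
    ∃ C : ℝ, 0 ≤ C ∧ ∀ h v, |mDiff m h K v| ≤ C * |h| ^ m := by
  induction m with
  | zero =>
    intro K hK hc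
    obtain ⟨C, hC⟩ := hK.continuous.bounded_above_of_compact_support hc
    exact ⟨C, (norm_nonneg _).trans (hC 0), fun h v => by simpa [mDiff_zero] using hC v⟩
  | succ m ih =>
    intro K hK hc
    obtain ⟨C, hC0, hC⟩ := ih (K := deriv K) (contDiff_infty_iff_deriv.1 hK).2 hc.deriv
    refine ⟨C, hC0, fun h v => ?_⟩
    rw [mDiff_succ, pow_succ, ← mul_assoc]
    have hd : Differentiable ℝ K := hK.differentiable (by simp)
    have := Convex.norm_image_sub_le_of_norm_hasDerivWithin_le (f := fun v => mDiff m h K v)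
      (f' := fun v => mDiff m h (deriv K) v) (s := univ) (x := v) (y := v + h) (C := C * |h| ^ m)
      (fun x _ => (mDiff_hasDeriv hd m h x).hasDerivWithinAt) (fun x _ => hC h x) convex_univ
      (mem_univ _) (mem_univ _)
    simpa using this

lemma exists_phi : ∃ φ : ℝ → ℝ, ContDiff ℝ ((⊤ : ℕ∞) : WithTop ℕ∞) φ ∧ HasCompactSupport φ ∧
    (∀ y, φ y ≠ 0 → 0 < y ∧ y < 1) ∧ ∫ y, φ y = 1 := by
  let B : ContDiffBump (1/2 : ℝ) := ⟨1/8, 1/4, by norm_num, by norm_num⟩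
  refine ⟨B.normed volume, B.contDiff_normed, B.hasCompactSupport_normed, fun y hy => ?_, B.integral_normed⟩
  have : y ∈ Function.support (B.normed volume) := hy
  rw [B.support_normed_eq, Metric.mem_ball, Real.dist_eq, abs_lt] at this
  have h : B.rOut = 1/4 := rfl
  rw [h] at this
  constructor <;> linarith [this.1, this.2]




/-- locally integrable strongly measurable functions -/
structure Loc (F : ℝ → X) : Prop where
  sm : StronglyMeasurable F
  fin : ∀ R : ℝ, ∫⁻ u in Icc (-R) R, ‖F u‖ₑ < ⊤

/-- bounded compactly supported measurable kernels -/
structure Ker (κ : ℝ → ℝ) (M R : ℝ) : Prop where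
  meas : Measurable κ
  bd : ∀ y, |κ y| ≤ M
  supp : ∀ y, κ y ≠ 0 → y ∈ Icc (-R) R

/-- averaging operator -/
def Av (κ : ℝ → ℝ) (F : ℝ → X) (x : ℝ) : X := ∫ y, κ y • F (x + y)

lemma Av_eq (κ : ℝ → ℝ) (F : ℝ → X) (x : ℝ) : Av κ F x = ∫ u, κ (u - x) • F u := by
  rw [Av, ← integral_add_left_eq_self (fun u => κ (u - x) • F u) x]
  simp

lemma Loc.sub {F G : ℝ → X} (hF : Loc F) (hG : Loc G) : Loc (fun x => F x - G x) where
  sm := hF.sm.sub hG.sm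
  fin R := by
    calc _ ≤ ∫⁻ u in Icc (-R) R, (‖F u‖ₑ + ‖G u‖ₑ) := lintegral_mono fun u => enorm_sub_le
      _ = _ := lintegral_add_left hF.sm.enorm _
      _ < ⊤ := ENNReal.add_lt_top.2 ⟨hF.fin R, hG.fin R⟩

lemma Ker.lint {κ : ℝ → ℝ} {M R : ℝ} (hκ : Ker κ M R) (F : ℝ → X) (x : ℝ) :
    ∫⁻ u, ‖κ (u - x) • F u‖ₑ ≤ ENNReal.ofReal M * ∫⁻ u in Icc (x - R) (x + R), ‖F u‖ₑ := by
  rw [← lintegral_indicator measurableSet_Icc, ← lintegral_const_mul' _ _ ENNReal.ofReal_ne_top]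
  refine lintegral_mono fun u => ?_
  by_cases h : κ (u - x) = 0
  · simp [h]
  have := hκ.supp _ h
  rw [indicator_of_mem (by constructor <;> linarith [this.1, this.2]), enorm_smul]
  gcongr
  rw [← ofReal_norm]
  exact ENNReal.ofReal_le_ofReal (hκ.bd _)

lemma Loc.fin' {F : ℝ → X} (hF : Loc F) (a b : ℝ) : ∫⁻ u in Icc a b, ‖F u‖ₑ < ⊤ :=
  lt_of_le_of_lt (lintegral_mono_set (Icc_subset_Icc
    (by linarith [neg_abs_le a, abs_nonneg b] : -(|a| + |b|) ≤ a)
    (by linarith [le_abs_self b, abs_nonneg a]))) (hF.fin (|a| + |b|))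

lemma Ker.integrable {κ : ℝ → ℝ} {M R : ℝ} (hκ : Ker κ M R) {F : ℝ → X} (hF : Loc F) (x : ℝ) :
    Integrable (fun u => κ (u - x) • F u) := by
  refine ⟨(StronglyMeasurable.smul (hκ.meas.comp (measurable_id.sub_const x)).stronglyMeasurable
    hF.sm).aestronglyMeasurable, ?_⟩
  exact lt_of_le_of_lt (hκ.lint F x) (ENNReal.mul_lt_top ENNReal.ofReal_lt_top (hF.fin' _ _))

lemma Ker.integrable' {κ : ℝ → ℝ} {M R : ℝ} (hκ : Ker κ M R) {F : ℝ → X} (hF : Loc F) (x : ℝ) :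
    Integrable (fun y => κ y • F (x + y)) := by
  have := (hκ.integrable hF x).comp_add_left x
  simpa using this

lemma Av_bd {κ : ℝ → ℝ} {M R : ℝ} (hκ : Ker κ M R) (F : ℝ → X) (x : ℝ) :
    ‖Av κ F x‖ₑ ≤ ENNReal.ofReal M * ∫⁻ u in Icc (x - R) (x + R), ‖F u‖ₑ := by
  rw [Av_eq]
  exact (enorm_integral_le_lintegral_enorm _).trans (hκ.lint F x)

lemma Loc.av {κ : ℝ → ℝ} {M R : ℝ} (hκ : Ker κ M R) {F : ℝ → X} (hF : Loc F) : Loc (Av κ F) where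
  sm := by
    have : StronglyMeasurable (fun z : ℝ × ℝ => κ z.2 • F (z.1 + z.2)) :=
      StronglyMeasurable.smul (hκ.meas.comp measurable_snd).stronglyMeasurable
        (hF.sm.comp_measurable (measurable_fst.add measurable_snd))
    exact this.integral_prod_right'
  fin S := by
    calc _ ≤ ∫⁻ u in Icc (-S) S, ENNReal.ofReal M * ∫⁻ v in Icc (-S - R) (S + R), ‖F v‖ₑ := by
          refine setLIntegral_mono measurable_const fun u hu => (Av_bd hκ F u).trans ?_
          gcongr
          · linarith [hu.1]
          · linarith [hu.2]
      _ = (ENNReal.ofReal M * ∫⁻ v in Icc (-S - R) (S + R), ‖F v‖ₑ) * volume (Icc (-S) S) :=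
          setLIntegral_const _ _
      _ < ⊤ := by
          have := (hF.fin' (-S - R) (S + R)).ne
          rw [Real.volume_Icc]
          exact ENNReal.mul_lt_top (ENNReal.mul_lt_top ENNReal.ofReal_lt_top this.lt_top)
            ENNReal.ofReal_lt_top

lemma Av_sub {κ : ℝ → ℝ} {M R : ℝ} (hκ : Ker κ M R) {F G : ℝ → X} (hF : Loc F) (hG : Loc G) (x : ℝ) :
    Av κ (fun x => F x - G x) x = Av κ F x - Av κ G x := by
  simp only [Av, smul_sub]
  exact integral_sub (hκ.integrable' hF x) (hκ.integrable' hG x)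

lemma Av_comm {κ κ' : ℝ → ℝ} {M R M' R' : ℝ} (hκ : Ker κ M R) (hκ' : Ker κ' M' R')
    {F : ℝ → X} (hF : Loc F) (x : ℝ) : Av κ (Av κ' F) x = Av κ' (Av κ F) x := by
  have e1 : Av κ (Av κ' F) x = ∫ y, ∫ z, (κ y * κ' z) • F (x + y + z) := by
    rw [Av]; congr 1; ext y
    rw [Av, ← integral_smul]
    simp only [smul_smul]
  have e2 : Av κ' (Av κ F) x = ∫ z, ∫ y, (κ y * κ' z) • F (x + y + z) := by
    rw [Av]; congr 1; ext y
    rw [Av, ← integral_smul]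
    simp only [smul_smul, mul_comm, add_right_comm]
  rw [e1, e2]
  apply integral_integral_swap
  have hm : StronglyMeasurable (Function.uncurry fun y z => (κ y * κ' z) • F (x + y + z)) :=
    StronglyMeasurable.smul ((hκ.meas.comp measurable_fst).mul
      (hκ'.meas.comp measurable_snd)).stronglyMeasurable
        (hF.sm.comp_measurable (by fun_prop))
  refine ⟨hm.aestronglyMeasurable, ?_⟩
  rw [hasFiniteIntegral_iff_enorm, lintegral_prod _ hm.enorm.aemeasurable]
  simp only [Function.uncurry_apply_pair]
  have hb : ∀ y, ∫⁻ z, ‖(κ y * κ' z) • F (x + y + z)‖ₑ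
      ≤ (Icc (-R) R).indicator (fun _ => ENNReal.ofReal M * (ENNReal.ofReal M' *
        ∫⁻ v in Icc (x - R - R') (x + R + R'), ‖F v‖ₑ)) y := by
    intro y
    by_cases h : κ y = 0
    · simp [h]
    have hy := hκ.supp _ h
    rw [indicator_of_mem hy]
    have := hκ'.lint F (x + y)
    rw [← lintegral_add_left_eq_self _ (x + y)] at this
    simp only [add_sub_cancel_left] at this
    have e : ∀ z, ‖(κ y * κ' z) • F (x + y + z)‖ₑ = ‖κ y‖ₑ * ‖κ' z • F (x + y + z)‖ₑ := by
      intro z; rw [mul_smul, enorm_smul]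
    simp only [e]
    rw [lintegral_const_mul' _ _ enorm_ne_top]
    gcongr
    · rw [← ofReal_norm]
      exact ENNReal.ofReal_le_ofReal (hκ.bd _)
    · refine this.trans ?_
      gcongr
      · linarith [hy.1]
      · linarith [hy.2]
  refine lt_of_le_of_lt (lintegral_mono hb) ?_
  rw [lintegral_indicator measurableSet_Icc, setLIntegral_const, Real.volume_Icc]
  exact ENNReal.mul_lt_top (ENNReal.mul_lt_top ENNReal.ofReal_lt_top
    (ENNReal.mul_lt_top ENNReal.ofReal_lt_top (hF.fin' _ _))) ENNReal.ofReal_lt_top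

lemma mDiff_Av {κ : ℝ → ℝ} {M R : ℝ} (hκ : Ker κ M R) {F : ℝ → X} (hF : Loc F) (m : ℕ) (h x : ℝ) :
    mDiff m h (Av κ F) x = ∫ u, (mDiff m (-h) κ (u - x)) • F u := by
  have : ∀ u, (mDiff m (-h) κ (u - x)) • F u = ∑ j ∈ Finset.range (m + 1),
      ((-1 : ℝ) ^ j * (m.choose j)) • (κ (u - (x + ((m : ℝ) - j) * h)) • F u) := by
    intro u
    rw [mDiff, Finset.sum_smul]
    refine Finset.sum_congr rfl fun j _ => ?_
    rw [smul_eq_mul, mul_smul]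
    congr 3; ring_nf
  simp only [this]
  have hi : ∀ j ∈ Finset.range (m + 1), Integrable (fun u => ((-1 : ℝ) ^ j * (m.choose j)) •
      (κ (u - (x + ((m : ℝ) - j) * h)) • F u)) := fun j _ => (hκ.integrable hF _).smul _
  rw [integral_finsetSum _ hi]
  rw [mDiff]
  refine Finset.sum_congr rfl fun j _ => ?_
  rw [integral_smul, Av_eq]

lemma mDiff_sub (m : ℕ) (h : ℝ) (f g : ℝ → X) (x : ℝ) :
    mDiff m h (fun x => f x - g x) x = mDiff m h f x - mDiff m h g x := by
  simp [mDiff, smul_sub, Finset.sum_sub_distrib]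




/-- half-line or line -/
def GoodI (I : Set ℝ) : Prop := I = univ ∨ I = Ioi (0:ℝ)

lemma GoodI.meas {I : Set ℝ} (hI : GoodI I) : MeasurableSet I := by
  rcases hI with rfl | rfl
  · exact MeasurableSet.univ
  · exact measurableSet_Ioi

lemma GoodI.up {I : Set ℝ} (hI : GoodI I) {x y : ℝ} (hx : x ∈ I) (hy : x ≤ y) : y ∈ I := by
  rcases hI with rfl | rfl
  · trivial
  · exact lt_of_lt_of_le hx hy

lemma GoodI.mid {I : Set ℝ} (hI : GoodI I) {x m t h : ℝ} (hx : x ∈ I) (hy : x + m * h ∈ I)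
    (ht : 0 ≤ t) (htm : t ≤ m) : x + t * h ∈ I := by
  rcases le_or_gt 0 h with h0 | h0
  · exact hI.up hx (by nlinarith)
  · exact hI.up hy (by nlinarith)

lemma measB {I : Set ℝ} (hI : GoodI I) (x ρ : ℝ) : MeasurableSet {u | u ∈ I ∧ |u - x| ≤ ρ} := by
  have h1 : MeasurableSet {u : ℝ | |u - x| ≤ ρ} := measurableSet_le (by fun_prop) (by fun_prop)
  exact hI.meas.inter h1

lemma measD {I : Set ℝ} (hI : GoodI I) (m : ℕ) (r x : ℝ) :
    MeasurableSet {h : ℝ | |h| < r ∧ x + (m : ℝ) * h ∈ I} := by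
  have h1 : MeasurableSet {h : ℝ | |h| < r} := measurableSet_lt (by fun_prop) (by fun_prop)
  have h2 : Measurable fun h : ℝ => x + (m:ℝ) * h := by fun_prop
  exact h1.inter (h2 hI.meas)

/-- scaled kernel -/
def Kr (r : ℝ) (K : ℝ → ℝ) (y : ℝ) : ℝ := r⁻¹ * K (y / r)

/-- smooth kernels supported in `(0,N)` -/
structure SK (K : ℝ → ℝ) (N : ℝ) : Prop where
  smooth : ContDiff ℝ ((⊤ : ℕ∞) : WithTop ℕ∞) K
  cpt : HasCompactSupport K
  supp : ∀ y, K y ≠ 0 → 0 < y ∧ y < N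

lemma SK.ker {K : ℝ → ℝ} {N : ℝ} (hK : SK K N) : ∃ M : ℝ, 0 ≤ M ∧ (∀ y, |K y| ≤ M) ∧
    ∀ r, 0 < r → Ker (Kr r K) (r⁻¹ * M) (N * r) := by
  obtain ⟨M, hM⟩ := hK.smooth.continuous.bounded_above_of_compact_support hK.cpt
  refine ⟨M, (norm_nonneg _).trans (hM 0), hM, fun r hr => ⟨?_, fun y => ?_, fun y hy => ?_⟩⟩
  · unfold Kr
    exact (hK.smooth.continuous.measurable.comp (measurable_id.div_const r)).const_mul _
  · rw [Kr, abs_mul, abs_of_pos (inv_pos.2 hr)]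
    have := hM (y / r)
    rw [Real.norm_eq_abs] at this
    gcongr
  · have h1 := hK.supp (y / r) (fun h => hy (by simp [Kr, h]))
    have h2 : y < N * r := (div_lt_iff₀ hr).1 h1.2
    have h3 : 0 < y := by simpa [hr] using mul_pos h1.1 hr
    exact ⟨by linarith, h2.le⟩

lemma mDiff_Kr (m : ℕ) (h r : ℝ) (K : ℝ → ℝ) (v : ℝ) :
    mDiff m h (Kr r K) v = r⁻¹ * mDiff m (h / r) K (v / r) := by
  simp only [mDiff, Kr, Finset.mul_sum, smul_eq_mul]
  refine Finset.sum_congr rfl fun j _ => ?_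
  rw [show (v + ((m:ℝ) - j) * h) / r = v / r + ((m:ℝ) - j) * (h / r) by ring]
  ring

lemma diff_Av {K : ℝ → ℝ} {N : ℝ} (hK : SK K N) (m : ℕ) :
    ∃ C : ℝ≥0∞, C ≠ ⊤ ∧ ∀ F : ℝ → X, Loc F → ∀ I, GoodI I → ∀ r h x : ℝ, 0 < r → |h| ≤ r →
      x ∈ I → x + m * h ∈ I → ‖mDiff m h (Av (Kr r K) F) x‖ₑ ≤
        C * ENNReal.ofReal ((|h| / r) ^ m) * ENNReal.ofReal r⁻¹ *
          ∫⁻ u in {u | u ∈ I ∧ |u - x| ≤ (m + N) * r}, ‖F u‖ₑ := by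
  obtain ⟨C, hC0, hC⟩ := mDiff_smooth m hK.smooth hK.cpt
  obtain ⟨M, hM0, hM, hker⟩ := hK.ker
  refine ⟨ENNReal.ofReal C, ENNReal.ofReal_ne_top, fun F hF I hI r h x hr hh hx hxm => ?_⟩
  have hms : MeasurableSet {u | u ∈ I ∧ |u - x| ≤ (m + N) * r} :=
    measB hI _ _
  rw [mDiff_Av (hker r hr) hF, ← lintegral_indicator hms]
  refine (enorm_integral_le_lintegral_enorm _).trans ?_
  rw [← lintegral_const_mul' _ _ (by finiteness)]
  refine lintegral_mono fun u => ?_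
  by_cases h0 : mDiff m (-h) (Kr r K) (u - x) = 0
  · simp [h0]
  have hmem : u ∈ {u | u ∈ I ∧ |u - x| ≤ (m + N) * r} := by
    rw [mDiff] at h0
    obtain ⟨j, hj, hj0⟩ := Finset.exists_ne_zero_of_sum_ne_zero h0
    have hj' : (j:ℝ) ≤ m := by exact_mod_cast Nat.lt_succ_iff.1 (Finset.mem_range.1 hj)
    have hj'' : (0:ℝ) ≤ j := by positivity
    have h1 := hK.supp ((u - x + ((m:ℝ) - j) * -h) / r) (fun h => hj0 (by rw [Kr, h, mul_zero, smul_zero]))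
    have h2 : u - x + ((m:ℝ) - j) * -h < N * r := (div_lt_iff₀ hr).1 h1.2
    have h3 : 0 < u - x + ((m:ℝ) - j) * -h := by
      have := mul_pos h1.1 hr
      rwa [div_mul_cancel₀ _ hr.ne'] at this
    have h4 := abs_le.1 hh
    refine ⟨hI.up (hI.mid hx hxm (t := (m:ℝ) - j) (by linarith) (by linarith)) (by linarith), ?_⟩
    have h5 : |((m:ℝ) - j) * h| ≤ m * r := by
      rw [abs_mul, abs_of_nonneg (by linarith : (0:ℝ) ≤ m - j)]
      exact mul_le_mul (by linarith) hh (abs_nonneg _) (by linarith)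
    have h6 := abs_le.1 h5
    rw [abs_le]
    constructor <;> nlinarith
  rw [indicator_of_mem hmem, enorm_smul]
  gcongr
  rw [mDiff_Kr, ← ofReal_norm, ← ENNReal.ofReal_mul hC0, ← ENNReal.ofReal_mul (by positivity)]
  apply ENNReal.ofReal_le_ofReal
  rw [norm_mul, Real.norm_eq_abs, Real.norm_eq_abs, abs_of_pos (inv_pos.2 hr), mul_comm]
  gcongr
  have := hC (-h / r) ((u - x) / r)
  rwa [abs_div, abs_neg, abs_of_pos hr] at this

lemma int_scale {φ : ℝ → ℝ} {N : ℝ} (hφ : SK φ N) {F : ℝ → X} (hF : Loc F) {r i : ℝ} (hr : 0 < r)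
    (hi : 0 < i) (x : ℝ) : Integrable (fun h => Kr r φ h • F (x + i * h)) ∧
      ∫ h, Kr r φ h • F (x + i * h) = ∫ y, (r⁻¹ * (i⁻¹ * φ (y / r / i))) • F (x + y) := by
  obtain ⟨M, hM0, hM, hker⟩ := hφ.ker
  have h1 := ((hker (r * i) (by positivity)).integrable' hF x)
  have h2 := (h1.comp_mul_left' hi.ne').smul i
  have e : ∀ h, Kr r φ h = i * Kr (r * i) φ (i * h) := by
    intro h
    rw [Kr, Kr, show i * h / (r * i) = h / r by field_simp]
    field_simp
  have e' : (fun h => Kr r φ h • F (x + i * h)) = fun h => i • (Kr (r * i) φ (i * h) • F (x + i * h)) := by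
    ext h; rw [e, mul_smul]
  constructor
  · rw [e']; exact h2
  · rw [e', integral_smul, Measure.integral_comp_mul_left (fun y => Kr (r * i) φ y • F (x + y)),
      smul_smul, abs_of_pos (inv_pos.2 hi), mul_inv_cancel₀ hi.ne', one_smul]
    congr 1; ext y
    rw [Kr, mul_inv, div_div, mul_assoc]

lemma good_kernel [CompleteSpace X] (m : ℕ) : ∃ K : ℝ → ℝ, SK K m ∧ ∃ C : ℝ≥0∞, C ≠ ⊤ ∧
    ∀ F : ℝ → X, Loc F → ∀ I, GoodI I → ∀ r x : ℝ, 0 < r → x ∈ I →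
      ‖F x - Av (Kr r K) F x‖ₑ ≤ C * dMean I m r F x := by
  obtain ⟨φ, hs, hc, hsup, hInt⟩ := exists_phi
  have hφ : SK φ 1 := ⟨hs, hc, hsup⟩
  obtain ⟨M, hM0, hM, hker⟩ := hφ.ker
  set c : ℕ → ℝ := fun j => (-1 : ℝ) ^ j * (m.choose j) with hcdef
  set K : ℝ → ℝ := fun y => ∑ j ∈ Finset.range m,
    (-((-1 : ℝ) ^ m * c j)) * (((m:ℝ) - j)⁻¹ * φ (y / ((m:ℝ) - j))) with hKdef
  have hjm : ∀ j ∈ Finset.range m, (0:ℝ) < (m:ℝ) - j ∧ (m:ℝ) - j ≤ m := by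
    intro j hj
    have : (j:ℝ) < m := by exact_mod_cast Finset.mem_range.1 hj
    exact ⟨by linarith, by simp⟩
  have hKsup : ∀ y, K y ≠ 0 → 0 < y ∧ y < m := by
    intro y hy
    obtain ⟨j, hj, hj0⟩ := Finset.exists_ne_zero_of_sum_ne_zero hy
    obtain ⟨h1, h2⟩ := hjm j hj
    have h3 := hsup (y / ((m:ℝ) - j)) (fun h => hj0 (by simp [h]))
    have h4 : 0 < y := by
      have := mul_pos h3.1 h1
      rwa [div_mul_cancel₀ _ h1.ne'] at this
    have h5 := (div_lt_iff₀ h1).1 h3.2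
    exact ⟨h4, by linarith⟩
  have hKs : ContDiff ℝ ((⊤ : ℕ∞) : WithTop ℕ∞) K := by
    refine ContDiff.sum fun j _ => ?_
    exact contDiff_const.mul (contDiff_const.mul (hs.comp (contDiff_id.div_const _)))
  have hKc : HasCompactSupport K := by
    refine HasCompactSupport.intro (isCompact_Icc (a := (0:ℝ)) (b := m)) fun y hy => ?_
    by_contra h
    exact hy ⟨(hKsup y h).1.le, (hKsup y h).2.le⟩
  refine ⟨K, ⟨hKs, hKc, hKsup⟩, ENNReal.ofReal M, ENNReal.ofReal_ne_top, fun F hF I hI r x hr hx => ?_⟩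
  have hT := fun j (hj : j ∈ Finset.range m) => int_scale hφ hF hr (hjm j hj).1 x
  have hφi : Integrable (Kr r φ) := by
    have := (hs.continuous.integrable_of_hasCompactSupport hc).comp_div (R := r) hr.ne'
    exact this.const_mul _
  have hφ1 : ∫ h, Kr r φ h = 1 := by
    simp only [Kr]
    rw [integral_const_mul, Measure.integral_comp_div φ r, hInt, abs_of_pos hr]
    simp [hr.ne']
  have eAv : Av (Kr r K) F x = ∑ j ∈ Finset.range m, (-((-1 : ℝ) ^ m * c j)) •
      ∫ h, Kr r φ h • F (x + ((m:ℝ) - j) * h) := by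
    have : ∀ y, Kr r K y • F (x + y) = ∑ j ∈ Finset.range m, (-((-1 : ℝ) ^ m * c j)) •
        ((r⁻¹ * (((m:ℝ) - j)⁻¹ * φ (y / r / ((m:ℝ) - j)))) • F (x + y)) := by
      intro y
      rw [Kr, hKdef]
      simp only [Finset.mul_sum, Finset.sum_smul, smul_smul]
      refine Finset.sum_congr rfl fun j _ => ?_
      congr 1; ring
    rw [Av]
    simp only [this]
    have hi : ∀ j ∈ Finset.range m, Integrable (fun y => (-((-1 : ℝ) ^ m * c j)) •
        ((r⁻¹ * (((m:ℝ) - j)⁻¹ * φ (y / r / ((m:ℝ) - j)))) • F (x + y))) := by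
      intro j hj
      have hp := (hjm j hj).1
      have := ((hker (r * ((m:ℝ) - j)) (mul_pos hr hp)).integrable' hF x).smul (-((-1 : ℝ) ^ m * c j))
      refine this.congr (Filter.Eventually.of_forall fun y => ?_)
      simp only [Pi.smul_apply, Kr]
      rw [mul_inv, div_div, mul_assoc]
    rw [integral_finsetSum _ hi]
    refine Finset.sum_congr rfl fun j hj => ?_
    rw [integral_smul, (hT j hj).2]
  have eD : ∫ h, Kr r φ h • mDiff m h F x = (∑ j ∈ Finset.range m, c j •
      ∫ h, Kr r φ h • F (x + ((m:ℝ) - j) * h)) + (-1 : ℝ) ^ m • F x := by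
    have : ∀ h, Kr r φ h • mDiff m h F x = (∑ j ∈ Finset.range m,
        c j • (Kr r φ h • F (x + ((m:ℝ) - j) * h))) + (-1 : ℝ) ^ m • (Kr r φ h • F x) := by
      intro h
      rw [mDiff, Finset.sum_range_succ, smul_add, Finset.smul_sum]
      congr 1
      · exact Finset.sum_congr rfl fun j _ => smul_comm _ _ _
      · rw [smul_comm]; simp
    simp only [this]
    have hi : ∀ j ∈ Finset.range m, Integrable (fun h => c j • (Kr r φ h • F (x + ((m:ℝ) - j) * h))) :=
      fun j hj => (hT j hj).1.smul _
    have hi2 : Integrable (fun h => (-1 : ℝ) ^ m • (Kr r φ h • F x)) := (hφi.smul_const _).smul _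
    rw [integral_add (integrable_finsetSum _ hi) hi2, integral_finsetSum _ hi]
    congr 1
    · refine Finset.sum_congr rfl fun j _ => integral_smul _ _
    · rw [integral_smul, integral_smul_const, hφ1, one_smul]
  have hsq : (-1 : ℝ) ^ m * (-1 : ℝ) ^ m = 1 := by rw [← mul_pow]; simp
  have eF : F x - Av (Kr r K) F x = (-1 : ℝ) ^ m • ∫ h, Kr r φ h • mDiff m h F x := by
    rw [eD, eAv, smul_add, smul_smul, hsq, one_smul, Finset.smul_sum, add_comm, sub_eq_add_neg,
      ← Finset.sum_neg_distrib]
    congr 1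
    refine Finset.sum_congr rfl fun j _ => ?_
    rw [smul_smul, neg_smul, neg_neg]
  rw [eF, enorm_smul]
  have : ‖(-1 : ℝ) ^ m‖ₑ = 1 := by simp [enorm_pow]
  rw [this, one_mul]
  refine (enorm_integral_le_lintegral_enorm _).trans ?_
  have hms := measD hI m r x
  rw [dMean, ← mul_assoc, ← lintegral_indicator hms, ← lintegral_const_mul' _ _ (by finiteness)]
  refine lintegral_mono fun h => ?_
  by_cases h0 : Kr r φ h = 0
  · simp [h0]
  have h1 := hsup (h / r) (fun h' => h0 (by simp [Kr, h']))
  have h2 : 0 < h := by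
    have := mul_pos h1.1 hr
    rwa [div_mul_cancel₀ _ hr.ne'] at this
  have h3 := (div_lt_iff₀ hr).1 h1.2
  have hmem : h ∈ {h : ℝ | |h| < r ∧ x + (m : ℝ) * h ∈ I} :=
    ⟨by rw [abs_of_pos h2]; linarith, hI.up hx (by
      have : (0:ℝ) ≤ (m:ℝ) * h := by positivity
      linarith)⟩
  rw [indicator_of_mem hmem, enorm_smul, ← enorm_eq_nnnorm, ← ENNReal.ofReal_mul hM0]
  gcongr
  rw [← ofReal_norm]
  have := (hker r hr).bd h
  exact ENNReal.ofReal_le_ofReal (by rw [mul_comm]; exact this)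




/-- powers of two -/
def e2 (a : ℝ) : ℝ≥0∞ := (2:ℝ≥0∞) ^ a

lemma e2_add (a b : ℝ) : e2 (a + b) = e2 a * e2 b := ENNReal.rpow_add _ _ (by simp) (by simp)
lemma e2_ne_top (a : ℝ) : e2 a ≠ ⊤ := by simp [e2]
lemma e2_ne_zero (a : ℝ) : e2 a ≠ 0 := by simp [e2]
lemma e2_zero : e2 0 = 1 := by simp [e2]
lemma e2_mono {a b : ℝ} (h : a ≤ b) : e2 a ≤ e2 b := ENNReal.rpow_le_rpow_of_exponent_le (by norm_num) h
lemma e2_rpow (a b : ℝ) : e2 a ^ b = e2 (a * b) := by rw [e2, e2, ENNReal.rpow_mul]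
lemma ofReal_e2 (a : ℝ) : ENNReal.ofReal ((2:ℝ) ^ a) = e2 a := by
  rw [e2, ← ENNReal.ofReal_rpow_of_pos (by norm_num)]; simp
lemma ofReal_zpow_e2 (k : ℤ) : ENNReal.ofReal ((2:ℝ) ^ k) = e2 k := by
  rw [← ofReal_e2, Real.rpow_intCast]
lemma ofReal_zpow_inv_e2 (k : ℤ) : ENNReal.ofReal ((2:ℝ) ^ k)⁻¹ = e2 (-k) := by
  rw [← zpow_neg, ofReal_zpow_e2]; push_cast; rfl

lemma e2_geom {δ : ℝ} (hδ : 0 < δ) : ∑' n : ℕ, e2 (-δ * n) ≠ ⊤ := by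
  have : ∀ n : ℕ, e2 (-δ * n) = e2 (-δ) ^ n := by
    intro n; rw [← e2_rpow, ENNReal.rpow_natCast]
  simp only [this]
  rw [ENNReal.tsum_geometric]
  have : e2 (-δ) < 1 := ENNReal.rpow_lt_one_of_one_lt_of_neg (by norm_num) (by linarith)
  rw [Ne, ENNReal.inv_eq_top]
  exact (tsub_pos_of_lt this).ne'

lemma e2_geomZ {δ : ℝ} (hδ : 0 < δ) : ∑' n : ℤ, e2 (-δ * |(n:ℝ)|) ≠ ⊤ := by
  rw [tsum_of_nat_of_neg_add_one ENNReal.summable ENNReal.summable]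
  refine ENNReal.add_ne_top.2 ⟨by simpa using e2_geom hδ, ?_⟩
  refine ne_top_of_le_ne_top (e2_geom hδ) (ENNReal.tsum_le_tsum fun n => e2_mono ?_)
  push_cast
  have : |(-((n:ℝ) + 1))| = n + 1 := by rw [abs_neg, abs_of_pos (by positivity)]
  have h2 : |(-1 + -(n:ℝ))| = n + 1 := by rw [← this]; congr 1; ring
  simp only [neg_add_rev, h2]
  nlinarith

lemma tel (u : ℕ → X) (hu : Filter.Tendsto (fun n => ‖u n‖ₑ) Filter.atTop (nhds 0)) :
    ‖u 0‖ₑ ≤ ∑' n, ‖u n - u (n + 1)‖ₑ := by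
  have h : ∀ N, ‖u 0‖ₑ ≤ (∑' n, ‖u n - u (n + 1)‖ₑ) + ‖u N‖ₑ := by
    intro N
    have : ‖u 0‖ₑ ≤ (∑ n ∈ Finset.range N, ‖u n - u (n + 1)‖ₑ) + ‖u N‖ₑ := by
      induction N with
      | zero => simp
      | succ N ih =>
        rw [Finset.sum_range_succ, add_assoc]
        refine ih.trans ?_
        gcongr
        calc ‖u N‖ₑ = ‖(u N - u (N + 1)) + u (N + 1)‖ₑ := by rw [sub_add_cancel]
          _ ≤ _ := enorm_add_le _ _
    refine this.trans ?_
    gcongr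
    exact ENNReal.sum_le_tsum _
  have := ge_of_tendsto' ((tendsto_const_nhds (x := ∑' n, ‖u n - u (n + 1)‖ₑ)).add hu) h
  simpa using this

/-- error of approximation -/
def er (K : ℝ → ℝ) (F : ℝ → X) (k : ℤ) (x : ℝ) : X := F x - Av (Kr ((2:ℝ) ^ k) K) F x

/-- block -/
def bl (K : ℝ → ℝ) (F : ℝ → X) (k : ℤ) (x : ℝ) : X :=
  Av (Kr ((2:ℝ) ^ k) K) F x - Av (Kr ((2:ℝ) ^ (k + 1)) K) F x

lemma er_loc {K : ℝ → ℝ} {N : ℝ} (hK : SK K N) {F : ℝ → X} (hF : Loc F) (k : ℤ) : Loc (er K F k) := by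
  obtain ⟨M, _, _, hker⟩ := hK.ker
  exact hF.sub (hF.av (hker _ (by positivity)))

lemma bl_eq {K : ℝ → ℝ} {N : ℝ} (hK : SK K N) {F : ℝ → X} (hF : Loc F) (k : ℤ) :
    bl K F k = fun x => Av (Kr ((2:ℝ) ^ k) K) (er K F (k + 1)) x
      - Av (Kr ((2:ℝ) ^ (k + 1)) K) (er K F k) x := by
  obtain ⟨M, _, _, hker⟩ := hK.ker
  have h1 := hker ((2:ℝ) ^ k) (by positivity)
  have h2 := hker ((2:ℝ) ^ (k + 1)) (by positivity)
  ext x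
  unfold er
  rw [Av_sub h1 hF (hF.av h2), Av_sub h2 hF (hF.av h1), Av_comm h1 h2 hF, bl]
  abel

lemma bl_bd {K : ℝ → ℝ} {N : ℝ} (hN : 0 ≤ N) (hK : SK K N) (m : ℕ) {s : ℝ} (hs : 0 < s) {D : ℝ≥0∞} (hD : D ≠ ⊤) :
    ∃ C : ℝ≥0∞, C ≠ ⊤ ∧ ∀ F : ℝ → X, Loc F → ∀ I, GoodI I → ∀ g : ℝ → ℝ≥0∞,
      (∀ k : ℤ, ∀ u ∈ I, ‖er K F k u‖ₑ ≤ D * e2 (k * s) * g u) → ∀ (k : ℤ) (h x : ℝ),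
      |h| ≤ (2:ℝ) ^ k → x ∈ I → x + m * h ∈ I → ‖mDiff m h (bl K F k) x‖ₑ ≤
        C * ENNReal.ofReal ((|h| / (2:ℝ) ^ k) ^ m) * e2 (k * (s - 1)) *
          ∫⁻ u in {u | u ∈ I ∧ |u - x| ≤ 2 * (m + N) * (2:ℝ) ^ k}, g u := by
  obtain ⟨C, hC, H⟩ := diff_Av (X := X) hK m
  refine ⟨C * D * e2 s + C * D * 1, ?_, fun F hF I hI g hg k h x hh hx hxm => ?_⟩
  · have := e2_ne_top s
    finiteness
  have p1 : (0:ℝ) < 2 ^ k := by positivity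
  have e21 : (2:ℝ) ^ (k + 1) = 2 * 2 ^ k := by rw [zpow_add₀ (by norm_num)]; ring
  have hmN : (0:ℝ) ≤ m + N := by positivity
  rw [bl_eq hK hF, mDiff_sub, add_mul, add_mul, add_mul]
  refine enorm_sub_le.trans (add_le_add ?_ ?_)
  · refine (H _ (er_loc hK hF (k + 1)) I hI (2 ^ k) h x p1 hh hx hxm).trans ?_
    calc _ ≤ C * ENNReal.ofReal ((|h| / (2:ℝ) ^ k) ^ m) * ENNReal.ofReal ((2:ℝ) ^ k)⁻¹ *
          ∫⁻ u in {u | u ∈ I ∧ |u - x| ≤ 2 * (m + N) * (2:ℝ) ^ k}, D * e2 (((k + 1 : ℤ) : ℝ) * s) * g u := by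
          refine mul_le_mul' le_rfl ?_
          refine (lintegral_mono_set ?_).trans (setLIntegral_mono' (measB hI _ _) fun u hu => hg _ u hu.1)
          rintro u ⟨h1, h2⟩
          exact ⟨h1, h2.trans (by nlinarith [mul_nonneg hmN p1.le])⟩
      _ = _ := by
          rw [lintegral_const_mul' _ _ (ENNReal.mul_ne_top hD (e2_ne_top _)), ofReal_zpow_inv_e2,
            show (((k + 1 : ℤ) : ℝ) * s) = k * s + s by push_cast; ring,
            show (k:ℝ) * (s - 1) = k * s + -k by ring, e2_add, e2_add]
          ring
  · refine (H _ (er_loc hK hF k) I hI (2 ^ (k + 1)) h x (by positivity) (by rw [e21]; linarith) hx hxm).trans ?_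
    calc _ ≤ C * ENNReal.ofReal ((|h| / (2:ℝ) ^ k) ^ m) * ENNReal.ofReal ((2:ℝ) ^ k)⁻¹ *
          ∫⁻ u in {u | u ∈ I ∧ |u - x| ≤ 2 * (m + N) * (2:ℝ) ^ k}, D * e2 ((k : ℝ) * s) * g u := by
          refine mul_le_mul' (mul_le_mul' (mul_le_mul' le_rfl ?_) ?_) ?_
          · apply ENNReal.ofReal_le_ofReal
            gcongr
            · norm_num
            · linarith
          · apply ENNReal.ofReal_le_ofReal
            gcongr
            · norm_num
            · linarith
          · refine (lintegral_mono_set ?_).trans (setLIntegral_mono' (measB hI _ _) fun u hu => hg _ u hu.1)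
            rintro u ⟨h1, h2⟩
            exact ⟨h1, h2.trans (by rw [e21]; nlinarith [mul_nonneg hmN p1.le])⟩
      _ = _ := by
          rw [lintegral_const_mul' _ _ (ENNReal.mul_ne_top hD (e2_ne_top _)), ofReal_zpow_inv_e2,
            show (k:ℝ) * (s - 1) = k * s + -k by ring, e2_add]
          ring




lemma lint_affine (G : ℝ → ℝ≥0∞) (hG : Measurable G) {i : ℝ} (hi : 1 ≤ i) (x : ℝ) :
    ∫⁻ h, G (x + i * h) ≤ ∫⁻ u, G u := by
  have h0 : i ≠ 0 := by linarith
  have e : ∫⁻ h, G (x + i * h) = ∫⁻ h, (fun y => G (x + y)) h ∂(Measure.map (i * ·) volume) := by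
    rw [lintegral_map (by fun_prop) (by fun_prop)]
  rw [e, Real.map_volume_mul_left h0, lintegral_smul_measure, lintegral_add_left_eq_self G x]
  calc _ ≤ (1:ℝ≥0∞) * ∫⁻ u, G u := by
        rw [smul_eq_mul]
        gcongr
        rw [abs_of_pos (by positivity)]
        exact ENNReal.ofReal_le_one.2 (inv_le_one_of_one_le₀ hi)
    _ = _ := one_mul _

/-- ball integrals -/
def Bi (I : Set ℝ) (c : ℝ) (g : ℝ → ℝ≥0∞) (x : ℝ) (l : ℤ) : ℝ≥0∞ :=
  ∫⁻ u in {u | u ∈ I ∧ |u - x| ≤ c * (2:ℝ) ^ l}, g u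

/-- main dyadic sum -/
def Sm (I : Set ℝ) (c s : ℝ) (m : ℕ) (g : ℝ → ℝ≥0∞) (x : ℝ) (k : ℤ) : ℝ≥0∞ :=
  ∑' l : ℤ, e2 (min 0 (((k:ℝ) - l) * m)) * (e2 (l * (s - 1)) * Bi I c g x l)

lemma Sm_term {I : Set ℝ} {c s : ℝ} {m : ℕ} {g : ℝ → ℝ≥0∞} {x : ℝ} (k l : ℤ) :
    e2 (min 0 (((k:ℝ) - l) * m)) * (e2 (l * (s - 1)) * Bi I c g x l) ≤ Sm I c s m g x k :=
  ENNReal.le_tsum (f := fun l : ℤ => e2 (min 0 (((k:ℝ) - l) * m)) * (e2 (l * (s - 1)) * Bi I c g x l)) l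

lemma dy_high {K : ℝ → ℝ} {N : ℝ} (hN : 0 ≤ N) (hK : SK K N) (m : ℕ) {s : ℝ} (hs : 0 < s) {D : ℝ≥0∞} (hD : D ≠ ⊤) :
    ∃ C : ℝ≥0∞, C ≠ ⊤ ∧ ∀ F : ℝ → X, Loc F → ∀ I, GoodI I → ∀ g : ℝ → ℝ≥0∞,
      (∀ k : ℤ, ∀ u ∈ I, ‖er K F k u‖ₑ ≤ D * e2 (k * s) * g u) →
      (∀ k : ℤ, ∀ y ∈ I, Filter.Tendsto (fun n : ℕ => Av (Kr ((2:ℝ) ^ (k + n)) K) F y) Filter.atTop (nhds 0)) →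
      ∀ (k : ℤ) (h x : ℝ),
      |h| ≤ (2:ℝ) ^ k → x ∈ I → x + m * h ∈ I → ‖mDiff m h (Av (Kr ((2:ℝ) ^ k) K) F) x‖ₑ ≤
        C * Sm I (2 * (m + N)) s m g x k := by
  obtain ⟨C, hC, H⟩ := bl_bd (X := X) hN hK m hs hD
  refine ⟨C, hC, fun F hF I hI g hg hdec k h x hh hx hxm => ?_⟩
  set u : ℕ → X := fun n => mDiff m h (Av (Kr ((2:ℝ) ^ (k + n)) K) F) x with hu
  have hu0 : u 0 = mDiff m h (Av (Kr ((2:ℝ) ^ k) K) F) x := by simp [hu]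
  have hlim : Filter.Tendsto u Filter.atTop (nhds 0) := by
    have : Filter.Tendsto u Filter.atTop (nhds (∑ j ∈ Finset.range (m + 1),
        ((-1 : ℝ) ^ j * (m.choose j)) • (0:X))) := by
      refine tendsto_finsetSum _ fun j hj => (hdec k _ ?_).const_smul _
      have hj' : (j:ℝ) ≤ m := by exact_mod_cast Nat.lt_succ_iff.1 (Finset.mem_range.1 hj)
      exact hI.mid hx hxm (by linarith) (by simp)
    simpa using this
  rw [← hu0]
  refine (tel u (by simpa using hlim.enorm)).trans ?_
  rw [Sm, ← ENNReal.tsum_mul_left]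
  refine le_trans (ENNReal.tsum_le_tsum fun n => ?_) (ENNReal.tsum_comp_le_tsum_of_injective
    (f := fun n : ℕ => k + (n:ℤ)) (fun a b hab => by simpa using hab) _)
  have e1 : u n - u (n + 1) = mDiff m h (bl K F (k + n)) x := by
    unfold bl
    rw [mDiff_sub, hu]
    simp only [Nat.cast_add, Nat.cast_one, add_assoc]
  rw [e1]
  have hle : (2:ℝ) ^ k ≤ (2:ℝ) ^ (k + n) := zpow_le_zpow_right₀ (by norm_num) (by linarith)
  refine (H F hF I hI g hg (k + n) h x (hh.trans hle) hx hxm).trans ?_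
  rw [mul_assoc, mul_assoc]
  refine mul_le_mul' le_rfl (mul_le_mul' ?_ le_rfl)
  have p : (0:ℝ) < 2 ^ k := by positivity
  have : |h| / (2:ℝ) ^ (k + n) ≤ (2:ℝ) ^ (-(n:ℝ)) := by
    rw [div_le_iff₀ (by positivity), zpow_add₀ (by norm_num), Real.rpow_neg (by norm_num)]
    simp only [Real.rpow_natCast, zpow_natCast]
    field_simp
    exact hh
  calc _ ≤ ENNReal.ofReal (((2:ℝ) ^ (-(n:ℝ))) ^ m) := by
        apply ENNReal.ofReal_le_ofReal; gcongr
    _ = e2 (-n * m) := by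
        rw [← Real.rpow_natCast, ← Real.rpow_mul (by norm_num), ofReal_e2]
    _ ≤ _ := by
        apply e2_mono
        push_cast
        rw [le_min_iff]
        have : (0:ℝ) ≤ (n:ℝ) * m := by positivity
        constructor <;> nlinarith

lemma dy_low {K : ℝ → ℝ} {N : ℝ} (hN : 0 ≤ N) (hK : SK K N) (m : ℕ) {s : ℝ} (hs : 0 < s) {D : ℝ≥0∞} (hD : D ≠ ⊤) :
    ∃ C : ℝ≥0∞, C ≠ ⊤ ∧ ∀ F : ℝ → X, Loc F → ∀ I, GoodI I → ∀ g : ℝ → ℝ≥0∞,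
      (∀ k : ℤ, ∀ u ∈ I, ‖er K F k u‖ₑ ≤ D * e2 (k * s) * g u) →
      ∀ (k : ℤ) (x : ℝ), x ∈ I → g x ≠ ⊤ → ‖er K F k x‖ₑ ≤
        C * Sm I (2 * (m + N)) s m g x k := by
  obtain ⟨C, hC, H⟩ := bl_bd (X := X) hN hK 0 hs hD
  refine ⟨C, hC, fun F hF I hI g hg k x hx hgx => ?_⟩
  set u : ℕ → X := fun n => er K F (k - n) x with hu
  have hu0 : u 0 = er K F k x := by simp [hu]
  have hlim : Filter.Tendsto (fun n => ‖u n‖ₑ) Filter.atTop (nhds 0) := by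
    have hb : ∀ n, ‖u n‖ₑ ≤ (D * e2 (k * s) * g x) * e2 (-s) ^ n := by
      intro n
      refine (hg (k - n) x hx).trans (le_of_eq ?_)
      rw [← ENNReal.rpow_natCast, e2_rpow,
        show (((k - n : ℤ) : ℝ) * s) = k * s + (-s * n) by push_cast; ring, e2_add]
      ring
    have h1 : e2 (-s) < 1 := ENNReal.rpow_lt_one_of_one_lt_of_neg (by norm_num) (by linarith)
    have h2 := ENNReal.Tendsto.const_mul (a := D * e2 (k * s) * g x)
      (ENNReal.tendsto_pow_atTop_nhds_zero_of_lt_one h1)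
      (Or.inr (ENNReal.mul_ne_top (ENNReal.mul_ne_top hD (e2_ne_top _)) hgx))
    rw [mul_zero] at h2
    exact tendsto_of_tendsto_of_tendsto_of_le_of_le tendsto_const_nhds h2 (fun _ => zero_le) hb
  rw [← hu0]
  refine (tel u hlim).trans ?_
  rw [Sm, ← ENNReal.tsum_mul_left]
  refine le_trans (ENNReal.tsum_le_tsum fun n => ?_) (ENNReal.tsum_comp_le_tsum_of_injective
    (f := fun n : ℕ => k - n - 1) (fun a b hab => by simpa using hab) _)
  have e1 : ‖u n - u (n + 1)‖ₑ = ‖mDiff 0 0 (bl K F (k - n - 1)) x‖ₑ := by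
    rw [mDiff_zero, hu]
    simp only [er, bl, Nat.cast_add, Nat.cast_one, sub_add_cancel]
    congr 1
    rw [show k - ((n:ℤ) + 1) = k - n - 1 by ring]
    abel
  rw [e1]
  refine (H F hF I hI g hg (k - n - 1) 0 x (by simp; positivity) hx (by simpa using hx)).trans ?_
  rw [pow_zero, ENNReal.ofReal_one, mul_one, mul_assoc]
  refine mul_le_mul' le_rfl ?_
  have : e2 (min 0 (((k:ℝ) - ((k - n - 1 : ℤ) : ℝ)) * m)) = 1 := by
    rw [min_eq_left, e2_zero]
    push_cast
    have : (0:ℝ) ≤ (n + 1) * (m:ℝ) := by positivity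
    nlinarith
  rw [this, one_mul]
  refine mul_le_mul' le_rfl ?_
  rw [Bi]
  refine lintegral_mono_set ?_
  rintro u ⟨h1, h2⟩
  refine ⟨h1, h2.trans ?_⟩
  gcongr
  simp





lemma enorm_mDiff_le (m : ℕ) (h : ℝ) (F : ℝ → X) (x : ℝ) :
    ‖mDiff m h F x‖ₑ ≤ ‖F x‖ₑ + ∑ j ∈ Finset.range m, (m.choose j : ℝ≥0∞) * ‖F (x + ((m:ℝ) - j) * h)‖ₑ := by
  have e : ∀ j : ℕ, ‖((-1 : ℝ) ^ j * (m.choose j))‖ₑ = (m.choose j : ℝ≥0∞) := by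
    intro j
    rw [enorm_mul, enorm_pow, enorm_neg]
    simp [← ofReal_norm]
  rw [mDiff, Finset.sum_range_succ, add_comm]
  refine (enorm_add_le _ _).trans (add_le_add ?_ ?_)
  · rw [enorm_smul, e]; simp
  · refine (enorm_sum_le _ _).trans (Finset.sum_le_sum fun j _ => ?_)
    rw [enorm_smul, e]

lemma dy_mean {K : ℝ → ℝ} {N : ℝ} (hN : 0 ≤ N) (hK : SK K N) (m : ℕ) {s : ℝ} (hs : 0 < s) {D : ℝ≥0∞} (hD : D ≠ ⊤) :
    ∃ C : ℝ≥0∞, C ≠ ⊤ ∧ ∀ F : ℝ → X, Loc F → ∀ I, GoodI I → ∀ g : ℝ → ℝ≥0∞, Measurable g →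
      (∀ k : ℤ, ∀ u ∈ I, ‖er K F k u‖ₑ ≤ D * e2 (k * s) * g u) →
      (∀ k : ℤ, ∀ y ∈ I, Filter.Tendsto (fun n : ℕ => Av (Kr ((2:ℝ) ^ (k + n)) K) F y) Filter.atTop (nhds 0)) →
      ∀ (k : ℤ) (x : ℝ), x ∈ I → g x ≠ ⊤ → dMean I m ((2:ℝ) ^ k) F x ≤
        C * Sm I (2 * (m + N)) s m g x k := by
  obtain ⟨C1, hC1, H1⟩ := dy_high (X := X) hN hK m hs hD
  obtain ⟨C2, hC2, H2⟩ := dy_low (X := X) hN hK m hs hD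
  refine ⟨(C1 + C2) * 2 + ∑ j ∈ Finset.range m, (m.choose j : ℝ≥0∞) * D, ?_,
    fun F hF I hI g hgm hg hdec k x hx hgx => ?_⟩
  · refine ENNReal.add_ne_top.2 ⟨by finiteness, ?_⟩
    exact (ENNReal.sum_lt_top.2 fun j _ => by
      exact ENNReal.mul_lt_top (by simp) hD.lt_top).ne
  set S := Sm I (2 * (m + N)) s m g x k with hS
  set A := {u | u ∈ I ∧ |u - x| ≤ 2 * (m + N) * (2:ℝ) ^ k} with hA
  have hAm : MeasurableSet A := measB hI _ _
  set G := A.indicator g with hG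
  have hGm : Measurable G := hgm.indicator hAm
  have p : (0:ℝ) < 2 ^ k := by positivity
  have hb : ∀ h ∈ {h : ℝ | |h| < (2:ℝ) ^ k ∧ x + (m : ℝ) * h ∈ I}, ‖mDiff m h F x‖ₑ ≤
      (C1 + C2) * S + ∑ j ∈ Finset.range m, ((m.choose j : ℝ≥0∞) * (D * e2 (k * s))) * G (x + ((m:ℝ) - j) * h) := by
    rintro h ⟨hh, hxm⟩
    have e1 : mDiff m h F x = mDiff m h (Av (Kr ((2:ℝ) ^ k) K) F) x + mDiff m h (er K F k) x := by
      unfold er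
      rw [mDiff_sub]; abel
    rw [e1, add_mul, add_assoc]
    refine (enorm_add_le _ _).trans (add_le_add (H1 F hF I hI g hg hdec k h x hh.le hx hxm) ?_)
    refine (enorm_mDiff_le _ _ _ _).trans (add_le_add (H2 F hF I hI g hg k x hx hgx) ?_)
    refine Finset.sum_le_sum fun j hj => ?_
    rw [mul_assoc]
    refine mul_le_mul' le_rfl ?_
    have hj' : (j:ℝ) ≤ m := by exact_mod_cast (Finset.mem_range.1 hj).le
    have hmem : x + ((m:ℝ) - j) * h ∈ I := hI.mid hx hxm (by linarith) (by simp)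
    refine (hg k _ hmem).trans (mul_le_mul' le_rfl ?_)
    rw [hG, Set.indicator_of_mem]
    refine ⟨hmem, ?_⟩
    rw [add_sub_cancel_left, abs_mul, abs_of_nonneg (by linarith)]
    have : (0:ℝ) ≤ j := by positivity
    have hm' : (0:ℝ) ≤ m := by positivity
    exact mul_le_mul (by linarith) hh.le (abs_nonneg _) (by positivity)
  have hvol : volume {h : ℝ | |h| < (2:ℝ) ^ k ∧ x + (m : ℝ) * h ∈ I} ≤ 2 * e2 k := by
    calc _ ≤ volume (Ioo (-(2:ℝ) ^ k) ((2:ℝ) ^ k)) := measure_mono fun h hh => abs_lt.1 hh.1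
      _ = _ := by
        rw [Real.volume_Ioo, ← ofReal_zpow_e2, show (2:ℝ) ^ k - -(2:ℝ) ^ k = 2 * 2 ^ k by ring,
          ENNReal.ofReal_mul (by norm_num)]
        simp
  have hterm : e2 (k * (s - 1)) * ∫⁻ u, G u ≤ S := by
    have := Sm_term (I := I) (c := 2 * (m + N)) (s := s) (m := m) (g := g) (x := x) k k
    rw [sub_self, zero_mul, min_self, e2_zero, one_mul] at this
    rw [hG, lintegral_indicator hAm]
    exact this
  have hInt : ∫⁻ h in {h : ℝ | |h| < (2:ℝ) ^ k ∧ x + (m : ℝ) * h ∈ I}, ‖mDiff m h F x‖ₑ ≤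
      (C1 + C2) * S * (2 * e2 k) + ∑ j ∈ Finset.range m, ((m.choose j : ℝ≥0∞) * (D * e2 (k * s))) * ∫⁻ u, G u := by
    refine (setLIntegral_mono' (measD hI m _ x) hb).trans ?_
    rw [lintegral_add_left measurable_const, setLIntegral_const]
    refine add_le_add (mul_le_mul' le_rfl hvol) ?_
    rw [lintegral_finsetSum _ (fun j _ => by fun_prop)]
    refine Finset.sum_le_sum fun j hj => ?_
    rw [lintegral_const_mul _ (by fun_prop)]
    refine mul_le_mul' le_rfl ((setLIntegral_le_lintegral _ _).trans (lint_affine G hGm ?_ x))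
    have : (j:ℝ) + 1 ≤ m := by exact_mod_cast (Finset.mem_range.1 hj)
    linarith
  rw [dMean, ofReal_zpow_inv_e2]
  refine (mul_le_mul' le_rfl hInt).trans ?_
  have ee : e2 (-k) * e2 k = 1 := by rw [← e2_add]; simp [e2_zero]
  have e3 : e2 (-k) * e2 (k * s) = e2 (k * (s - 1)) := by rw [← e2_add]; ring_nf
  rw [mul_add, add_mul ((C1 + C2) * 2) _ S, Finset.mul_sum, Finset.sum_mul]
  refine add_le_add (le_of_eq ?_) (Finset.sum_le_sum fun j _ => ?_)
  · calc _ = (C1 + C2) * S * 2 * (e2 (-k) * e2 k) := by ring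
      _ = _ := by rw [ee]; ring
  · calc _ = (m.choose j : ℝ≥0∞) * D * (e2 (-k) * e2 (k * s) * ∫⁻ u, G u) := by ring
      _ ≤ _ := by rw [e3]; gcongr

/-- summing over dyadic scales -/
lemma sum_Sm {s s1 : ℝ} {m : ℕ} (hs1 : 0 < s1) (hm : s1 < m) : ∃ C : ℝ≥0∞, C ≠ ⊤ ∧
    ∀ (I : Set ℝ) (c : ℝ) (g : ℝ → ℝ≥0∞) (x : ℝ),
    ∑' k : ℤ, e2 (-k * s1) * Sm I c s m g x k ≤ C * ∑' l : ℤ, e2 (l * (s - s1 - 1)) * Bi I c g x l := by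
  have hδ : 0 < min s1 (m - s1) := lt_min hs1 (by linarith)
  refine ⟨∑' n : ℤ, e2 (-(min s1 (m - s1)) * |(n:ℝ)|), e2_geomZ hδ, fun I c g x => ?_⟩
  set δ := min s1 (m - s1)
  have hδ1 : δ ≤ s1 := min_le_left _ _
  have hδ2 : δ ≤ m - s1 := min_le_right _ _
  simp only [Sm, ← ENNReal.tsum_mul_left]
  rw [ENNReal.tsum_comm]
  refine ENNReal.tsum_le_tsum fun l => ?_
  have : ∀ k : ℤ, e2 (-k * s1) * (e2 (min 0 (((k:ℝ) - l) * m)) * (e2 (l * (s - 1)) * Bi I c g x l))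
      ≤ e2 (-δ * |((k - l : ℤ) : ℝ)|) * (e2 (l * (s - s1 - 1)) * Bi I c g x l) := by
    intro k
    rw [← mul_assoc, ← mul_assoc, ← mul_assoc, ← e2_add, ← e2_add, ← e2_add]
    refine mul_le_mul' (e2_mono ?_) le_rfl
    push_cast
    have : min 0 (((k:ℝ) - l) * m) ≤ ((k:ℝ) - l) * s1 - δ * |(k:ℝ) - l| := by
      rcases le_total 0 ((k:ℝ) - l) with h | h
      · rw [abs_of_nonneg h]
        refine (min_le_left _ _).trans ?_
        nlinarith
      · rw [abs_of_nonpos h]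
        refine (min_le_right _ _).trans ?_
        nlinarith
    nlinarith
  refine (ENNReal.tsum_le_tsum this).trans ?_
  rw [ENNReal.tsum_mul_right]
  refine mul_le_mul' (le_of_eq ?_) le_rfl
  exact (Equiv.subRight l).tsum_eq (fun n : ℤ => e2 (-δ * |(n:ℝ)|))

lemma sum_Bi {β c : ℝ} (hβ : β < 0) (hc : 0 < c) : ∃ C : ℝ≥0∞, C ≠ ⊤ ∧
    ∀ (I : Set ℝ), GoodI I → ∀ (g : ℝ → ℝ≥0∞), Measurable g → ∀ (x : ℝ),
    ∑' l : ℤ, e2 (l * β) * Bi I c g x l ≤ C * ∫⁻ u in I, pw (x - u) β * g u := by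
  refine ⟨(∑' n : ℕ, e2 (-(-β) * n)) * (pw c (-β)), ENNReal.mul_ne_top (e2_geom (by linarith)) (pw_ne_top _ _), fun I hI g hg x => ?_⟩
  set Z := ∑' n : ℕ, e2 (-(-β) * n) with hZ
  have hAm : ∀ l : ℤ, MeasurableSet {u | u ∈ I ∧ |u - x| ≤ c * (2:ℝ) ^ l} := fun l => measB hI _ _
  have e1 : ∀ l : ℤ, e2 (l * β) * Bi I c g x l =
      ∫⁻ u in I, e2 (l * β) * {u | u ∈ I ∧ |u - x| ≤ c * (2:ℝ) ^ l}.indicator g u := by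
    intro l
    rw [lintegral_const_mul' _ _ (e2_ne_top _), setLIntegral_indicator (hAm l), Bi]
    congr 3
    ext u; constructor
    · exact fun h => ⟨h, h.1⟩
    · exact fun h => h.1
  simp only [e1]
  rw [← lintegral_tsum (fun l => ((hg.indicator (hAm l)).const_mul _).aemeasurable),
    ← lintegral_const_mul' _ _ (ENNReal.mul_ne_top (e2_geom (by linarith)) (pw_ne_top _ _))]
  refine lintegral_mono_ae ?_
  filter_upwards [ae_restrict_of_ae (ae_ne x)] with u hu
  have hpos : 0 < |x - u| / c := div_pos (abs_pos.2 (sub_ne_zero.2 hu.symm)) hc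
  obtain ⟨l0, h1, h2⟩ := exists_mem_Ioc_zpow hpos (y := (2:ℝ)) (by norm_num)
  have hb : ∀ l : ℤ, e2 (l * β) * {u | u ∈ I ∧ |u - x| ≤ c * (2:ℝ) ^ l}.indicator g u ≤
      (if l0 + 1 ≤ l then e2 (l * β) else 0) * g u := by
    intro l
    by_cases hl : l0 + 1 ≤ l
    · rw [if_pos hl]
      exact mul_le_mul' le_rfl (Set.indicator_le_self _ _ _)
    · rw [if_neg hl, Set.indicator_of_notMem, mul_zero, zero_mul]
      rintro ⟨_, h⟩
      have : (2:ℝ) ^ l ≤ 2 ^ l0 := zpow_le_zpow_right₀ (by norm_num) (by omega)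
      rw [lt_div_iff₀ hc] at h1
      rw [abs_sub_comm] at h
      nlinarith
  refine (ENNReal.tsum_le_tsum hb).trans ?_
  rw [ENNReal.tsum_mul_right, ← mul_assoc]
  refine mul_le_mul' ?_ le_rfl
  have e4 : ∑' l : ℤ, (if l0 + 1 ≤ l then e2 (l * β) else 0) = e2 ((l0 + 1) * β) * Z := by
    rw [hZ, ← ENNReal.tsum_mul_left, ← (Equiv.addRight (l0 + 1)).tsum_eq,
      tsum_of_nat_of_neg_add_one ENNReal.summable ENNReal.summable]
    have z : ∑' n : ℕ, (fun c_1 : ℤ => if l0 + 1 ≤ (Equiv.addRight (l0 + 1)) c_1 then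
      e2 (((Equiv.addRight (l0 + 1)) c_1 : ℤ) * β) else 0) (-((n:ℤ) + 1)) = 0 := by
      rw [ENNReal.tsum_eq_zero]
      intro n
      refine if_neg ?_
      simp only [Equiv.coe_addRight]
      omega
    refine (congrArg₂ (· + ·) ?_ z).trans (add_zero _)
    refine tsum_congr fun n => ?_
    refine (if_pos (by simp only [Equiv.coe_addRight]; omega)).trans ?_
    rw [← e2_add]
    congr 1
    simp only [Equiv.coe_addRight]
    push_cast; ring
  rw [e4, mul_comm, mul_assoc]
  refine mul_le_mul' le_rfl ?_
  have hx0 : x - u ≠ 0 := sub_ne_zero.2 hu.symm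
  have e5 : e2 ((l0 + 1) * β) = pw ((2:ℝ) ^ (l0 + 1)) β := by
    rw [pw, abs_of_pos (by positivity), ← Real.rpow_intCast, ← Real.rpow_mul (by norm_num), ofReal_e2]
    push_cast; rfl
  have e6 : pw c (-β) * pw (x - u) β = pw ((x - u) / c) β := by
    rw [div_eq_inv_mul, pw_mul_arg]
    congr 1
    rw [pw, pw, abs_inv, Real.inv_rpow (abs_nonneg _), Real.rpow_neg (abs_nonneg _)]
  rw [e5, e6]
  refine pw_le_of_le_neg (div_ne_zero hx0 hc.ne') ?_ hβ.le
  rw [abs_div, abs_of_pos hc, abs_of_pos (by positivity : (0:ℝ) < 2 ^ (l0 + 1))]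
  exact h2




lemma hold_bd {p γ : ℝ} (hp : 1 < p) (hγ1 : -1 < γ) (hγ2 : γ < p - 1) {F : ℝ → X}
    (hF : StronglyMeasurable F) (hW : ∫⁻ x, pw x γ * ‖F x‖ₑ ^ p ≠ ⊤) :
    ∃ C : ℝ≥0∞, C ≠ ⊤ ∧ ∀ R : ℝ, 0 < R → ∫⁻ y in {y : ℝ | |y| < R}, ‖F y‖ₑ ≤ C * pw R (1 - (1 + γ) / p) := by
  have p0 : 0 < p := by linarith
  have hp1 : 0 < p - 1 := by linarith
  have hpq : p.HolderConjugate (p / (p - 1)) := by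
    rw [Real.holderConjugate_iff]; refine ⟨hp, ?_⟩; field_simp; ring
  have hB : -1 < -(γ / (p - 1)) := by
    rw [neg_lt_neg_iff, div_lt_one hp1]; exact hγ2
  obtain ⟨C, hC, H⟩ := pw_near hB
  have q0 : 0 < p / (p - 1) := by positivity
  refine ⟨(∫⁻ x, pw x γ * ‖F x‖ₑ ^ p) ^ (1 / p) * C ^ (1 / (p / (p - 1))),
    ENNReal.mul_ne_top (ENNReal.rpow_ne_top_of_nonneg (by positivity) hW)
      (ENNReal.rpow_ne_top_of_nonneg (by positivity) hC), fun R hR => ?_⟩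
  have hm : MeasurableSet {y : ℝ | |y| < R} := measurableSet_lt (by fun_prop) (by fun_prop)
  have m1 : Measurable fun y => pw y (γ / p) * ‖F y‖ₑ := (measurable_pw _).mul hF.enorm
  have m2 : Measurable fun y => pw y (-(γ / p)) := measurable_pw _
  calc _ = ∫⁻ y in {y : ℝ | |y| < R}, ((fun y => pw y (γ / p) * ‖F y‖ₑ) * (fun y => pw y (-(γ / p)))) y := by
        refine lintegral_congr_ae ?_
        filter_upwards [ae_restrict_of_ae (ae_ne 0)] with y hy
        simp only [Pi.mul_apply]
        rw [mul_right_comm, pw_mul hy, add_neg_cancel, pw_zero, one_mul]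
    _ ≤ _ := ENNReal.lintegral_mul_le_Lp_mul_Lq _ hpq m1.aemeasurable m2.aemeasurable
    _ ≤ (∫⁻ x, pw x γ * ‖F x‖ₑ ^ p) ^ (1 / p) * (C * pw R (-(γ / (p - 1)) + 1)) ^ (1 / (p / (p - 1))) := by
        refine mul_le_mul' (ENNReal.rpow_le_rpow ?_ (by positivity)) (ENNReal.rpow_le_rpow ?_ (by positivity))
        · refine (setLIntegral_le_lintegral _ _).trans (le_of_eq (lintegral_congr_ae ?_))
          filter_upwards [ae_ne 0] with y hy
          rw [ENNReal.mul_rpow_of_nonneg _ _ p0.le, pw_rpow hy, div_mul_cancel₀ _ p0.ne']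
        · refine le_trans (le_of_eq (lintegral_congr_ae ?_)) (H R hR)
          filter_upwards [ae_restrict_of_ae (ae_ne 0)] with y hy
          rw [pw_rpow hy]
          congr 1
          field_simp
    _ = _ := by
        rw [ENNReal.mul_rpow_of_nonneg _ _ (by positivity), pw_rpow hR.ne', mul_assoc]
        congr 3
        field_simp
        ring

lemma Loc_of {p γ : ℝ} (hp : 1 < p) (hγ1 : -1 < γ) (hγ2 : γ < p - 1) {F : ℝ → X}
    (hF : StronglyMeasurable F) (hW : ∫⁻ x, pw x γ * ‖F x‖ₑ ^ p ≠ ⊤) : Loc F where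
  sm := hF
  fin := by
    obtain ⟨C, hC, H⟩ := hold_bd hp hγ1 hγ2 hF hW
    intro R
    refine lt_of_le_of_lt ((lintegral_mono_set ?_).trans (H (|R| + 1) (by positivity)))
      (ENNReal.mul_ne_top hC (pw_ne_top _ _)).lt_top
    rintro y ⟨h1, h2⟩
    have := le_abs_self R
    show |y| < |R| + 1
    rw [abs_lt]
    constructor <;> linarith

lemma decay_of {p γ : ℝ} (hp : 1 < p) (hγ1 : -1 < γ) (hγ2 : γ < p - 1) {F : ℝ → X}
    (hF : StronglyMeasurable F) (hW : ∫⁻ x, pw x γ * ‖F x‖ₑ ^ p ≠ ⊤) {K : ℝ → ℝ} {N : ℝ} (hN : 0 ≤ N)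
    (hK : SK K N) (k : ℤ) (y : ℝ) :
    Filter.Tendsto (fun n : ℕ => Av (Kr ((2:ℝ) ^ (k + n)) K) F y) Filter.atTop (nhds 0) := by
  obtain ⟨C, hC, H⟩ := hold_bd hp hγ1 hγ2 hF hW
  obtain ⟨M, hM, _, hker⟩ := hK.ker
  have p0 : 0 < p := by linarith
  set β := 1 - (1 + γ) / p with hβ
  have hβ0 : 0 ≤ β := by
    rw [hβ, sub_nonneg, div_le_one p0]; linarith
  have hβ1 : 0 < 1 - β := by
    rw [hβ, _root_.sub_sub_cancel]; exact div_pos (by linarith) p0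
  have hr : Filter.Tendsto (fun n : ℕ => (2:ℝ) ^ (k + n)) Filter.atTop Filter.atTop := by
    have : (fun n : ℕ => (2:ℝ) ^ (k + n)) = fun n : ℕ => (2:ℝ) ^ k * 2 ^ n := by
      ext n; rw [zpow_add₀ (by norm_num), zpow_natCast]
    rw [this]
    exact (tendsto_pow_atTop_atTop_of_one_lt (by norm_num)).const_mul_atTop (by positivity)
  have hb : ∀ r : ℝ, 1 ≤ r → ‖Av (Kr r K) F y‖ₑ ≤
      (ENNReal.ofReal M * C * pw (|y| + N + 1) β) * ENNReal.ofReal (r ^ (-(1 - β))) := by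
    intro r hr1
    have r0 : 0 < r := by linarith
    refine (Av_bd (hker r r0) F y).trans ?_
    calc _ ≤ ENNReal.ofReal (r⁻¹ * M) * (C * pw ((|y| + N + 1) * r) β) := by
          refine mul_le_mul' le_rfl ((lintegral_mono_set ?_).trans (H _ (by positivity)))
          rintro u ⟨h1, h2⟩
          have a1 := le_abs_self y
          have a2 := neg_abs_le y
          have a3 : |y| ≤ |y| * r := le_mul_of_one_le_right (abs_nonneg _) hr1
          show |u| < (|y| + N + 1) * r
          rw [abs_lt]
          constructor <;> nlinarith
      _ = _ := by
          rw [pw_mul_arg, ENNReal.ofReal_mul (by positivity), neg_sub, Real.rpow_sub r0, Real.rpow_one,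
            div_eq_mul_inv, ENNReal.ofReal_mul (by positivity)]
          simp only [pw, abs_of_pos r0]
          ring
  rw [tendsto_zero_iff_enorm_tendsto_zero]
  have h2 : Filter.Tendsto (fun n : ℕ => (ENNReal.ofReal M * C * pw (|y| + N + 1) β) *
      ENNReal.ofReal (((2:ℝ) ^ (k + n)) ^ (-(1 - β)))) Filter.atTop (nhds 0) := by
    have := ENNReal.Tendsto.const_mul (a := ENNReal.ofReal M * C * pw (|y| + N + 1) β)
      (ENNReal.tendsto_ofReal ((tendsto_rpow_neg_atTop hβ1).comp hr))
      (Or.inr (by have := pw_ne_top (|y| + N + 1) β; finiteness))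
    simpa using this
  refine tendsto_of_tendsto_of_tendsto_of_le_of_le' tendsto_const_nhds h2
    (Filter.Eventually.of_forall fun _ => zero_le) ?_
  filter_upwards [hr.eventually_ge_atTop 1] with n hn
  exact hb _ hn




lemma dMean_le {I : Set ℝ} {m : ℕ} {t t' : ℝ} (ht : 0 < t) (h1 : t ≤ t') (h2 : t' ≤ 2 * t) (f : ℝ → X) (x : ℝ) :
    dMean I m t f x ≤ 2 * dMean I m t' f x := by
  rw [dMean, dMean, ← mul_assoc]
  refine mul_le_mul' ?_ (lintegral_mono_set fun h hh => ⟨hh.1.trans_le h1, hh.2⟩)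
  rw [show (2:ℝ≥0∞) = ENNReal.ofReal 2 by simp, ← ENNReal.ofReal_mul (by norm_num)]
  apply ENNReal.ofReal_le_ofReal
  rw [← div_eq_mul_inv, le_div_iff₀ (by linarith), inv_mul_le_iff₀ ht]
  linarith

/-- dyadic coefficients -/
def bk (I : Set ℝ) (s : ℝ) (m : ℕ) (f : ℝ → X) (x : ℝ) (k : ℤ) : ℝ≥0∞ :=
  e2 (-k * s) * dMean I m ((2:ℝ) ^ k) f x

/-- dyadic sup -/
def gS (I : Set ℝ) (s : ℝ) (m : ℕ) (f : ℝ → X) (x : ℝ) : ℝ≥0∞ := ⨆ k : ℤ, bk I s m f x k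

lemma ofReal_zrpow_e2 (k : ℤ) (s : ℝ) : ENNReal.ofReal (((2:ℝ) ^ k) ^ s) = e2 (k * s) := by
  rw [← Real.rpow_intCast, ← Real.rpow_mul (by norm_num), ofReal_e2]

lemma e2_one : e2 1 = 2 := by simp [e2]

lemma bk_le {I : Set ℝ} {s : ℝ} (hs : 0 ≤ s) {m : ℕ} (f : ℝ → X) (x : ℝ) (k : ℤ) {t : ℝ}
    (h1 : (2:ℝ) ^ k ≤ t) (h2 : t ≤ (2:ℝ) ^ (k + 1)) :
    bk I s m f x k ≤ e2 (s + 1) * (ENNReal.ofReal (t ^ (-s)) * dMean I m t f x) := by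
  have p : (0:ℝ) < 2 ^ k := by positivity
  have e21 : (2:ℝ) ^ (k + 1) = 2 * 2 ^ k := by rw [zpow_add₀ (by norm_num)]; ring
  calc bk I s m f x k ≤ e2 (-k * s) * (2 * dMean I m t f x) := by
        rw [bk]; gcongr; exact dMean_le p h1 (by linarith) f x
    _ = e2 (s + 1) * (e2 (((k + 1 : ℤ):ℝ) * -s) * dMean I m t f x) := by
        rw [← mul_assoc, ← mul_assoc, ← e2_add, ← e2_one, ← e2_add]
        congr 2; push_cast; ring
    _ ≤ _ := by
        refine mul_le_mul' le_rfl (mul_le_mul' ?_ le_rfl)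
        rw [← ofReal_zrpow_e2]
        exact ENNReal.ofReal_le_ofReal (Real.rpow_le_rpow_of_nonpos (by linarith) h2 (by linarith))

lemma le_bk {I : Set ℝ} {s : ℝ} (hs : 0 ≤ s) {m : ℕ} (f : ℝ → X) (x : ℝ) (k : ℤ) {t : ℝ}
    (h1 : (2:ℝ) ^ k ≤ t) (h2 : t ≤ (2:ℝ) ^ (k + 1)) :
    ENNReal.ofReal (t ^ (-s)) * dMean I m t f x ≤ e2 (s + 1) * bk I s m f x (k + 1) := by
  have p : (0:ℝ) < 2 ^ k := by positivity
  have e21 : (2:ℝ) ^ (k + 1) = 2 * 2 ^ k := by rw [zpow_add₀ (by norm_num)]; ring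
  calc _ ≤ e2 (k * -s) * (2 * dMean I m (2 ^ (k + 1)) f x) := by
        refine mul_le_mul' ?_ (dMean_le (by linarith) h2 (by linarith) f x)
        rw [← ofReal_zrpow_e2]
        exact ENNReal.ofReal_le_ofReal (Real.rpow_le_rpow_of_nonpos p h1 (by linarith))
    _ = _ := by
        rw [bk, ← mul_assoc, ← mul_assoc, ← e2_add, ← e2_one, ← e2_add]
        congr 2; push_cast; ring

lemma vol_dy (k : ℤ) : volume (Ico ((2:ℝ) ^ k) ((2:ℝ) ^ (k + 1))) = e2 k := by
  rw [Real.volume_Ico, ← ofReal_zpow_e2, zpow_add₀ (by norm_num)]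
  congr 1; ring

lemma ofReal_inv_lo {t : ℝ} (k : ℤ) (ht : 0 < t) (h2 : t ≤ (2:ℝ) ^ k) : e2 (-k) ≤ (ENNReal.ofReal t)⁻¹ := by
  rw [← ofReal_zpow_inv_e2, ← ENNReal.ofReal_inv_of_pos ht]
  apply ENNReal.ofReal_le_ofReal; gcongr

lemma ofReal_inv_hi {t : ℝ} (k : ℤ) (h2 : (2:ℝ) ^ k ≤ t) : (ENNReal.ofReal t)⁻¹ ≤ e2 (-k) := by
  have p : (0:ℝ) < 2 ^ k := by positivity
  rw [← ofReal_zpow_inv_e2, ← ENNReal.ofReal_inv_of_pos (by linarith)]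
  apply ENNReal.ofReal_le_ofReal; gcongr

lemma gS_le {s : ℝ} (hs : 0 ≤ s) {q : ℝ≥0∞} (hq : 1 ≤ q) : ∃ C : ℝ≥0∞, C ≠ ⊤ ∧
    ∀ (I : Set ℝ) (m : ℕ) (f : ℝ → X) (x : ℝ), gS I s m f x ≤ C * innerQ I s q m f x := by
  by_cases hqt : q = ⊤
  · refine ⟨1, by simp, fun I m f x => iSup_le fun k => ?_⟩
    rw [one_mul, innerQ, if_pos hqt]
    refine le_trans (le_of_eq ?_) (le_iSup₂ ((2:ℝ) ^ k) (by positivity))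
    rw [bk, ofReal_zrpow_e2]
    congr 2; ring
  · set r := q.toReal with hr
    have hr1 : 1 ≤ r := by simpa using ENNReal.toReal_mono hqt hq
    have r0 : 0 < r := by linarith
    refine ⟨e2 (s + 1) * e2 (1 / r), ENNReal.mul_ne_top (e2_ne_top _) (e2_ne_top _),
      fun I m f x => iSup_le fun k => ?_⟩
    rw [innerQ, if_neg hqt]
    set J := ∫⁻ t in Ioi (0:ℝ), (ENNReal.ofReal (t ^ (-s)) * dMean I m t f x) ^ q.toReal *
        (ENNReal.ofReal t)⁻¹ with hJ
    set a := bk I s m f x k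
    have h1 : a ^ r * e2 (-(k + 1 : ℤ)) * e2 k ≤ e2 (s + 1) ^ r * J := by
      calc _ = ∫⁻ t in Ico ((2:ℝ) ^ k) ((2:ℝ) ^ (k + 1)), a ^ r * e2 (-(k + 1 : ℤ)) := by
            rw [setLIntegral_const, vol_dy]
        _ ≤ ∫⁻ t in Ico ((2:ℝ) ^ k) ((2:ℝ) ^ (k + 1)), e2 (s + 1) ^ r *
            ((ENNReal.ofReal (t ^ (-s)) * dMean I m t f x) ^ q.toReal * (ENNReal.ofReal t)⁻¹) := by
            refine setLIntegral_mono' measurableSet_Ico fun t ht => ?_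
            rw [← mul_assoc, ← ENNReal.mul_rpow_of_nonneg _ _ r0.le]
            have p : (0:ℝ) < 2 ^ k := by positivity
            exact mul_le_mul' (ENNReal.rpow_le_rpow (bk_le hs f x k ht.1 ht.2.le) r0.le)
              (ofReal_inv_lo _ (p.trans_le ht.1) ht.2.le)
        _ ≤ _ := by
            rw [lintegral_const_mul' _ _ (ENNReal.rpow_ne_top_of_nonneg r0.le (e2_ne_top _))]
            refine mul_le_mul' le_rfl (lintegral_mono_set fun t ht => ?_)
            have p : (0:ℝ) < 2 ^ k := by positivity
            exact p.trans_le ht.1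
    have h2 : a ^ r ≤ e2 1 * (e2 (s + 1) ^ r * J) := by
      calc a ^ r = e2 1 * (a ^ r * e2 (-(k + 1 : ℤ)) * e2 k) := by
            rw [mul_assoc (a ^ r), mul_left_comm, ← e2_add, ← e2_add]
            push_cast
            rw [show (1:ℝ) + (-((k:ℝ) + 1) + k) = 0 by ring, e2_zero, mul_one]
        _ ≤ _ := by gcongr
    calc a = (a ^ r) ^ (1 / r) := by rw [← ENNReal.rpow_mul, mul_one_div_cancel r0.ne', ENNReal.rpow_one]
      _ ≤ (e2 1 * (e2 (s + 1) ^ r * J)) ^ (1 / r) := by gcongr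
      _ = _ := by
        rw [ENNReal.mul_rpow_of_nonneg _ _ (by positivity), ENNReal.mul_rpow_of_nonneg _ _ (by positivity),
          ← ENNReal.rpow_mul, mul_one_div_cancel r0.ne', ENNReal.rpow_one, e2_rpow, one_mul]
        ring

lemma sum_rpow_le (b : ℤ → ℝ≥0∞) {r : ℝ} (hr : 1 ≤ r) : ∑' k, b k ^ r ≤ (∑' k, b k) ^ r := by
  have e : ∀ a : ℝ≥0∞, a ^ r = a * a ^ (r - 1) := by
    intro a
    conv_lhs => rw [show r = 1 + (r - 1) by ring]
    rw [ENNReal.rpow_add_of_nonneg _ _ (by norm_num) (by linarith), ENNReal.rpow_one]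
  rw [e (∑' k, b k), ← ENNReal.tsum_mul_right]
  refine ENNReal.tsum_le_tsum fun k => ?_
  rw [e]
  exact mul_le_mul' le_rfl (ENNReal.rpow_le_rpow (ENNReal.le_tsum k) (by linarith))

lemma innerQ_le {s : ℝ} (hs : 0 ≤ s) {q : ℝ≥0∞} (hq : 1 ≤ q) : ∃ C : ℝ≥0∞, C ≠ ⊤ ∧
    ∀ (I : Set ℝ) (m : ℕ) (f : ℝ → X) (x : ℝ), innerQ I s q m f x ≤ C * ∑' k, bk I s m f x k := by
  refine ⟨e2 (s + 1), e2_ne_top _, fun I m f x => ?_⟩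
  have hdy : ∀ t : ℝ, 0 < t → ∃ k : ℤ, t ∈ Ico ((2:ℝ) ^ k) ((2:ℝ) ^ (k + 1)) := fun t ht =>
    exists_mem_Ico_zpow ht (by norm_num)
  by_cases hqt : q = ⊤
  · rw [innerQ, if_pos hqt]
    refine iSup₂_le fun t ht => ?_
    obtain ⟨k, h1, h2⟩ := hdy t ht
    exact (le_bk hs f x k h1 h2.le).trans (mul_le_mul' le_rfl (ENNReal.le_tsum _))
  · rw [innerQ, if_neg hqt]
    set r := q.toReal with hr
    have hr1 : 1 ≤ r := by simpa using ENNReal.toReal_mono hqt hq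
    have r0 : 0 < r := by linarith
    have : ∫⁻ t in Ioi (0:ℝ), (ENNReal.ofReal (t ^ (-s)) * dMean I m t f x) ^ r * (ENNReal.ofReal t)⁻¹
        ≤ (e2 (s + 1) * ∑' k, bk I s m f x k) ^ r := by
      calc _ ≤ ∫⁻ t in ⋃ k : ℤ, Ico ((2:ℝ) ^ k) ((2:ℝ) ^ (k + 1)),
            (ENNReal.ofReal (t ^ (-s)) * dMean I m t f x) ^ r * (ENNReal.ofReal t)⁻¹ :=
            lintegral_mono_set fun t ht => Set.mem_iUnion.2 (hdy t ht)
        _ ≤ _ := lintegral_iUnion_le _ _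
        _ ≤ ∑' k : ℤ, (e2 (s + 1) * bk I s m f x (k + 1)) ^ r := by
            refine ENNReal.tsum_le_tsum fun k => ?_
            calc _ ≤ ∫⁻ t in Ico ((2:ℝ) ^ k) ((2:ℝ) ^ (k + 1)), (e2 (s + 1) * bk I s m f x (k + 1)) ^ r * e2 (-k) :=
                  setLIntegral_mono' measurableSet_Ico fun t ht =>
                    mul_le_mul' (ENNReal.rpow_le_rpow (le_bk hs f x k ht.1 ht.2.le) r0.le)
                      (ofReal_inv_hi _ ht.1)
              _ = _ := by
                  rw [setLIntegral_const, vol_dy, mul_assoc, ← e2_add, neg_add_cancel, e2_zero, mul_one]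
        _ = ∑' k : ℤ, (e2 (s + 1) * bk I s m f x k) ^ r :=
            (Equiv.addRight (1:ℤ)).tsum_eq (fun k => (e2 (s + 1) * bk I s m f x k) ^ r)
        _ ≤ _ := sum_rpow_le _ hr1
        _ = _ := by rw [ENNReal.tsum_mul_left]
    calc _ ≤ ((e2 (s + 1) * ∑' k, bk I s m f x k) ^ r) ^ (1 / r) := by gcongr
      _ = _ := by rw [← ENNReal.rpow_mul, mul_one_div_cancel r0.ne', ENNReal.rpow_one]

lemma meas_dMean {I : Set ℝ} (hI : GoodI I) (m : ℕ) (t : ℝ) {F : ℝ → X} (hF : StronglyMeasurable F) :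
    Measurable fun x => dMean I m t F x := by
  have hS : MeasurableSet {p : ℝ × ℝ | |p.2| < t ∧ p.1 + (m:ℝ) * p.2 ∈ I} := by
    have h1 : MeasurableSet {p : ℝ × ℝ | |p.2| < t} := measurableSet_lt (by fun_prop) (by fun_prop)
    have h2 : Measurable fun p : ℝ × ℝ => p.1 + (m:ℝ) * p.2 := by fun_prop
    exact h1.inter (h2 hI.meas)
  have hm : StronglyMeasurable fun p : ℝ × ℝ => mDiff m p.2 F p.1 := by
    unfold mDiff
    refine Finset.stronglyMeasurable_fun_sum _ fun j _ => ?_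
    exact (hF.comp_measurable (g := fun p : ℝ × ℝ => p.1 + ((m:ℝ) - j) * p.2) (by fun_prop)).const_smul _
  have h := ((hm.enorm.indicator hS).lintegral_prod_right' (ν := volume)).const_mul (ENNReal.ofReal t⁻¹)
  have e : (fun x => dMean I m t F x) = fun x => ENNReal.ofReal t⁻¹ * ∫⁻ h,
      {p : ℝ × ℝ | |p.2| < t ∧ p.1 + (m:ℝ) * p.2 ∈ I}.indicator (fun p => ‖mDiff m p.2 F p.1‖ₑ) (x, h) := by
    ext x
    rw [dMean, ← lintegral_indicator (measD hI m t x)]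
    rfl
  rw [e]
  exact h

lemma meas_gS {I : Set ℝ} (hI : GoodI I) (s : ℝ) (m : ℕ) {F : ℝ → X} (hF : StronglyMeasurable F) :
    Measurable fun x => gS I s m F x :=
  Measurable.iSup fun k => (meas_dMean hI m _ hF).const_mul _




lemma ds_pow {p : ℝ} (hp : 0 < p) (J : ℝ≥0∞) : (J ^ p) ^ (1 / p) = J := by
  rw [← ENNReal.rpow_mul, mul_one_div_cancel hp.ne', ENNReal.rpow_one]

lemma wnorm_mono {I : Set ℝ} (hI : GoodI I) {p γ : ℝ} (hp : 0 < p) {C : ℝ≥0∞} (hC : C ≠ ⊤) {f g : ℝ → ℝ≥0∞}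
    (h : ∀ᵐ x ∂volume.restrict I, f x ≤ C * g x) :
    (∫⁻ x in I, pw x γ * f x ^ p) ^ (1 / p) ≤ C * (∫⁻ x in I, pw x γ * g x ^ p) ^ (1 / p) := by
  calc _ ≤ (C ^ p * ∫⁻ x in I, pw x γ * g x ^ p) ^ (1 / p) := by
        refine ENNReal.rpow_le_rpow ?_ (by positivity)
        rw [← lintegral_const_mul' _ _ (ENNReal.rpow_ne_top_of_nonneg hp.le hC)]
        refine lintegral_mono_ae (h.mono fun x hx => ?_)
        rw [mul_left_comm, ← ENNReal.mul_rpow_of_nonneg _ _ hp.le]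
        gcongr
    _ = _ := by rw [ENNReal.mul_rpow_of_nonneg _ _ (by positivity), ds_pow hp]

lemma core [CompleteSpace X]
    (p0 p1 s0 s1 γ0 γ1 : ℝ) (q0 q1 : ℝ≥0∞) (m0 m1 : ℕ)
    (hp0 : 1 < p0) (hpp : p0 ≤ p1) (hq0 : 1 ≤ q0) (hq1 : 1 ≤ q1)
    (hs1 : 0 < s1) (hs01 : s1 < s0)
    (hγ0 : γ0 ∈ Ioo (-1 : ℝ) (p0 - 1)) (hγ1 : γ1 ∈ Ioo (-1 : ℝ) (p1 - 1))
    (hw : γ1 / p1 ≤ γ0 / p0)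
    (hsob : s0 - (1 + γ0) / p0 = s1 - (1 + γ1) / p1)
    (hm0 : s0 < m0) (hm1 : s1 < m1)
    (I : Set ℝ) (hI : GoodI I) :
    ∃ C : ℝ≥0∞, C ≠ ⊤ ∧ ∀ f : ℝ → X, StronglyMeasurable f → (∫⁻ x, pw x γ0 * ‖f x‖ₑ ^ p0 ≠ ⊤) →
        diffSeminorm I s1 p1 γ1 q1 m1 f ≤ C * diffSeminorm I s0 p0 γ0 q0 m0 f := by
  have s0p : 0 < s0 := by linarith
  have p0p : 0 < p0 := by linarith
  have p1p : 0 < p1 := by linarith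
  obtain ⟨K, hK, D, hD, HD⟩ := good_kernel (X := X) m0
  have hN : (0:ℝ) ≤ m0 := by positivity
  have hNp : (0:ℝ) < m0 := by linarith
  obtain ⟨C1, hC1, H1⟩ := dy_mean (X := X) hN hK m1 s0p hD
  obtain ⟨C2, hC2, H2⟩ := sum_Sm (s := s0) hs1 hm1
  have hα1 : s0 - s1 - 1 < 0 := by
    have h1 : (1 + γ0) / p0 < 1 := by rw [div_lt_one p0p]; linarith [hγ0.2]
    have h2 : 0 < (1 + γ1) / p1 := div_pos (by linarith [hγ1.1]) p1p
    linarith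
  obtain ⟨C3, hC3, H3⟩ := sum_Bi (c := 2 * ((m1:ℝ) + m0)) hα1 (by positivity)
  obtain ⟨C4, hC4, H4⟩ := innerQ_le (X := X) hs1.le hq1
  obtain ⟨C5, hC5, H5⟩ := gS_le (X := X) s0p.le hq0
  obtain ⟨C6, hC6, H6⟩ := stein_weiss (p := p0) (q := p1) (a := γ0 / p0) (c := γ1 / p1) (α := s0 - s1) hp0 hpp
    (by rw [div_lt_iff₀ p0p, sub_mul, one_div_mul_cancel p0p.ne']; linarith [hγ0.2])
    (by rw [← neg_div, div_lt_div_iff_of_pos_right p1p]; exact hγ1.1)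
    hw (by rw [add_div, add_div] at hsob; linarith) (by linarith)
  set CC := C4 * (C1 * (C2 * C3)) with hCC
  have hCCt : CC ≠ ⊤ := by finiteness
  refine ⟨CC * (C6 * C5) + 1, by finiteness, fun f hf hW => ?_⟩
  by_cases htop : diffSeminorm I s0 p0 γ0 q0 m0 f = ⊤
  · rw [htop, ENNReal.mul_top (by simp)]; exact le_top
  refine le_trans ?_ (mul_le_mul' (le_self_add (a := CC * (C6 * C5)) (b := 1)) le_rfl)
  have hLoc : Loc f := Loc_of hp0 hγ0.1 hγ0.2 hf hW
  set g := fun x => gS I s0 m0 f x with hg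
  have hgm : Measurable g := meas_gS hI s0 m0 hf
  have hgn : (∫⁻ x in I, pw x γ0 * g x ^ p0) ^ (1 / p0) ≤ C5 * diffSeminorm I s0 p0 γ0 q0 m0 f :=
    wnorm_mono hI p0p hC5 (ae_of_all _ fun x => H5 I m0 f x)
  have hgn' : ∫⁻ x in I, pw x γ0 * g x ^ p0 ≠ ⊤ := by
    intro h
    rw [h, ENNReal.top_rpow_of_pos (by positivity)] at hgn
    exact (ENNReal.mul_ne_top hC5 htop) (top_le_iff.1 hgn)
  have hgfin : ∀ᵐ x ∂volume.restrict I, g x ≠ ⊤ := by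
    have h1 := ae_lt_top ((measurable_pw γ0).mul (hgm.pow_const p0)) hgn'
    filter_upwards [h1, ae_restrict_of_ae (ae_ne 0)] with x hx hx0 htop
    simp only [Pi.mul_apply, htop] at hx
    rw [ENNReal.top_rpow_of_pos p0p, ENNReal.mul_top (pw_ne_zero hx0 _)] at hx
    exact lt_irrefl _ hx
  have hbd : ∀ k : ℤ, ∀ u ∈ I, ‖er K f k u‖ₑ ≤ D * e2 (k * s0) * g u := by
    intro k u hu
    refine (HD f hLoc I hI _ u (by positivity) hu).trans ?_
    rw [mul_assoc]
    refine mul_le_mul' le_rfl ?_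
    calc _ = e2 (k * s0) * bk I s0 m0 f u k := by
          rw [bk, ← mul_assoc, ← e2_add, show (k:ℝ) * s0 + -k * s0 = 0 by ring, e2_zero, one_mul]
      _ ≤ _ := mul_le_mul' le_rfl (le_iSup (fun k => bk I s0 m0 f u k) k)
  have hdec : ∀ k : ℤ, ∀ y ∈ I, Filter.Tendsto (fun n : ℕ => Av (Kr ((2:ℝ) ^ (k + n)) K) f y) Filter.atTop (nhds 0) :=
    fun k y _ => decay_of hp0 hγ0.1 hγ0.2 hf hW hN hK k y
  set T := fun x => ∫⁻ u in I, pw (x - u) (s0 - s1 - 1) * g u with hT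
  have hpt : ∀ᵐ x ∂volume.restrict I, innerQ I s1 q1 m1 f x ≤ CC * T x := by
    filter_upwards [hgfin, ae_restrict_mem hI.meas] with x hx hxI
    calc _ ≤ C4 * ∑' k, bk I s1 m1 f x k := H4 I m1 f x
      _ ≤ C4 * ∑' k : ℤ, C1 * (e2 (-k * s1) * Sm I (2 * (m1 + m0)) s0 m1 g x k) := by
          refine mul_le_mul' le_rfl (ENNReal.tsum_le_tsum fun k => ?_)
          rw [mul_left_comm]
          exact mul_le_mul' le_rfl (H1 f hLoc I hI g hgm hbd hdec k x hxI hx)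
      _ ≤ C4 * (C1 * (C2 * (C3 * T x))) := by
          rw [ENNReal.tsum_mul_left]
          exact mul_le_mul' le_rfl (mul_le_mul' le_rfl ((H2 I _ g x).trans
            (mul_le_mul' le_rfl (H3 I hI g hgm x))))
      _ = _ := by rw [hCC]; ring
  refine (wnorm_mono (γ := γ1) hI p1p hCCt hpt).trans ?_
  rw [mul_assoc CC, mul_assoc C6]
  refine mul_le_mul' le_rfl ?_
  set u := I.indicator (fun y => pw y (γ0 / p0) * g y) with hu
  have hum : Measurable u := ((measurable_pw _).mul hgm).indicator hI.meas
  have hSW := H6 u hum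
  have e1 : ∫⁻ y, u y ^ p0 = ∫⁻ x in I, pw x γ0 * g x ^ p0 := by
    rw [← lintegral_indicator hI.meas]
    refine lintegral_congr_ae ?_
    filter_upwards [ae_ne 0] with y hy
    by_cases hyI : y ∈ I
    · rw [hu, Set.indicator_of_mem hyI, Set.indicator_of_mem hyI, ENNReal.mul_rpow_of_nonneg _ _ p0p.le,
        pw_rpow hy, div_mul_cancel₀ _ p0p.ne']
    · rw [hu, Set.indicator_of_notMem hyI, Set.indicator_of_notMem hyI, ENNReal.zero_rpow_of_pos p0p]
  rw [e1] at hSW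
  refine le_trans ?_ (hSW.trans (mul_le_mul' le_rfl hgn))
  refine ENNReal.rpow_le_rpow ?_ (by positivity)
  refine le_trans ?_ (setLIntegral_le_lintegral I _)
  refine lintegral_mono_ae ?_
  filter_upwards [ae_restrict_of_ae (ae_ne 0)] with x hx
  have e2' : (∫⁻ y, (pw x (γ1 / p1) * pw (x - y) (s0 - s1 - 1) * pw y (-(γ0 / p0))) * u y) = pw x (γ1 / p1) * T x := by
    rw [hT]
    dsimp only
    rw [← lintegral_const_mul' _ _ (pw_ne_top _ _), ← lintegral_indicator hI.meas]
    refine lintegral_congr_ae ?_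
    filter_upwards [ae_ne 0] with y hy
    by_cases hyI : y ∈ I
    · rw [hu, Set.indicator_of_mem hyI, Set.indicator_of_mem hyI]
      calc _ = pw x (γ1 / p1) * (pw (x - y) (s0 - s1 - 1) * g y) * (pw y (-(γ0 / p0)) * pw y (γ0 / p0)) := by ring
        _ = _ := by rw [pw_mul hy, neg_add_cancel, pw_zero, mul_one]
    · rw [hu, Set.indicator_of_notMem hyI, Set.indicator_of_notMem hyI, mul_zero]
  rw [e2', ENNReal.mul_rpow_of_nonneg _ _ p1p.le, pw_rpow hx, div_mul_cancel₀ _ p1p.ne']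




lemma qmp_affine (x : ℝ) {i : ℝ} (hi : i ≠ 0) :
    Measure.QuasiMeasurePreserving (fun h : ℝ => x + i * h) volume volume := by
  have h1 : Measure.QuasiMeasurePreserving (fun h : ℝ => i * h) volume volume := by
    refine ⟨by fun_prop, ?_⟩
    rw [Real.map_volume_mul_left hi]
    exact Measure.smul_absolutelyContinuous
  exact (measurePreserving_add_left volume x).quasiMeasurePreserving.comp h1

lemma dMean_congr {Y : Type*} [NormedAddCommGroup Y] [NormedSpace ℝ Y] (ι : X →ₗᵢ[ℝ] Y)
    {I : Set ℝ} (hI : GoodI I) (m : ℕ) {f : ℝ → X} {F : ℝ → Y}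
    (h : ∀ᵐ u, u ∈ I → F u = ι (f u)) : ∀ᵐ x ∂volume.restrict I, ∀ t, dMean I m t f x = dMean I m t F x := by
  filter_upwards [(ae_restrict_iff' hI.meas).2 h, ae_restrict_mem hI.meas] with x hx hxI t
  have hall : ∀ᵐ h : ℝ, ∀ j ∈ Finset.range m, x + ((m:ℝ) - j) * h ∈ I →
      F (x + ((m:ℝ) - j) * h) = ι (f (x + ((m:ℝ) - j) * h)) := by
    rw [Finset.eventually_all]
    intro j hj
    have hj' : (j:ℝ) < m := by exact_mod_cast (Finset.mem_range.1 hj)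
    exact (qmp_affine x (i := (m:ℝ) - j) (by linarith)).ae h
  rw [dMean, dMean]
  congr 1
  refine setLIntegral_congr_fun_ae (measD hI m t x) ?_
  filter_upwards [hall] with h hh hV
  have : mDiff m h F x = ι (mDiff m h f x) := by
    rw [mDiff, mDiff, map_sum]
    refine Finset.sum_congr rfl fun j hj => ?_
    rw [map_smul]
    congr 1
    have hj1 : j ≤ m := Nat.lt_succ_iff.1 (Finset.mem_range.1 hj)
    rcases hj1.lt_or_eq with hlt | rfl
    · have hj' : (j:ℝ) < m := by exact_mod_cast hlt
      exact hh j (Finset.mem_range.2 hlt) (hI.mid hxI hV.2 (by linarith) (by simp))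
    · simpa using hx
  rw [this]
  simp [← enorm_eq_nnnorm]

lemma ds_congr {Y : Type*} [NormedAddCommGroup Y] [NormedSpace ℝ Y] (ι : X →ₗᵢ[ℝ] Y)
    {I : Set ℝ} (hI : GoodI I) (s p γ : ℝ) (q : ℝ≥0∞) (m : ℕ) {f : ℝ → X} {F : ℝ → Y}
    (h : ∀ᵐ u, u ∈ I → F u = ι (f u)) : diffSeminorm I s p γ q m f = diffSeminorm I s p γ q m F := by
  rw [diffSeminorm, diffSeminorm]
  congr 1
  refine lintegral_congr_ae ?_
  filter_upwards [dMean_congr ι hI m h] with x hx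
  simp only [innerQ, hx]

lemma final
    (p0 p1 s0 s1 γ0 γ1 : ℝ) (q0 q1 : ℝ≥0∞) (m0 m1 : ℕ)
    (hp0 : 1 < p0) (hpp : p0 ≤ p1) (hq0 : 1 ≤ q0) (hq1 : 1 ≤ q1)
    (hs1 : 0 < s1) (hs01 : s1 < s0)
    (hγ0 : γ0 ∈ Ioo (-1 : ℝ) (p0 - 1)) (hγ1 : γ1 ∈ Ioo (-1 : ℝ) (p1 - 1))
    (hw : γ1 / p1 ≤ γ0 / p0)
    (hsob : s0 - (1 + γ0) / p0 = s1 - (1 + γ1) / p1)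
    (hm0 : s0 < m0) (hm1 : s1 < m1)
    (I : Set ℝ) (hI : I = univ ∨ I = Ioi (0:ℝ)) :
    ∃ C : ℝ≥0∞, C ≠ ⊤ ∧ ∀ f : ℝ → X,
      AEStronglyMeasurable f (volume.restrict I) → wLpNorm I p0 γ0 f < ⊤ →
        diffSeminorm I s1 p1 γ1 q1 m1 f ≤ C * diffSeminorm I s0 p0 γ0 q0 m0 f := by
  have hG : GoodI I := hI
  have p0p : 0 < p0 := by linarith
  obtain ⟨C, hC, H⟩ := core (X := UniformSpace.Completion X) p0 p1 s0 s1 γ0 γ1 q0 q1 m0 m1 hp0 hpp hq0 hq1 hs1 hs01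
    hγ0 hγ1 hw hsob hm0 hm1 I hG
  refine ⟨C, hC, fun f hf hfin => ?_⟩
  set ι : X →ₗᵢ[ℝ] UniformSpace.Completion X := UniformSpace.Completion.toComplₗᵢ
  set F := I.indicator (fun x => ι (hf.mk f x)) with hF
  have hFm : StronglyMeasurable F :=
    (ι.continuous.comp_stronglyMeasurable hf.stronglyMeasurable_mk).indicator hG.meas
  have hae : ∀ᵐ u, u ∈ I → F u = ι (f u) := by
    filter_upwards [(ae_restrict_iff' hG.meas).1 hf.ae_eq_mk] with u hu huI
    rw [hF, Set.indicator_of_mem huI, hu huI]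
  rw [ds_congr ι hG _ _ _ _ _ hae, ds_congr ι hG _ _ _ _ _ hae]
  refine H F hFm ?_
  have h1 : ∫⁻ x, pw x γ0 * ‖F x‖ₑ ^ p0 = ∫⁻ x in I, pw x γ0 * ‖f x‖ₑ ^ p0 := by
    rw [← lintegral_indicator hG.meas]
    refine lintegral_congr_ae ?_
    filter_upwards [hae] with x hx
    by_cases hxI : x ∈ I
    · rw [Set.indicator_of_mem hxI, hx hxI, ι.enorm_map]
    · rw [Set.indicator_of_notMem hxI, hF, Set.indicator_of_notMem hxI, enorm_zero,
        ENNReal.zero_rpow_of_pos p0p, mul_zero]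
  rw [h1]
  intro h
  have h2 : wLpNorm I p0 γ0 f = (∫⁻ x in I, pw x γ0 * ‖f x‖ₑ ^ p0) ^ (1 / p0) := rfl
  rw [h2, h, ENNReal.top_rpow_of_pos (by positivity)] at hfin
  exact lt_irrefl _ hfin


/-- **Homogeneous Sobolev embedding estimate.** For `1 < p_0 ≤ p_1 < ∞`,
`q_0, q_1 ∈ [1,∞]`, `s_0 > s_1 > 0`, `γ_i ∈ (-1, p_i - 1)` with `γ_0/p_0 ≥ γ_1/p_1`,
`s_0 - (1+γ_0)/p_0 = s_1 - (1+γ_1)/p_1`, and integers `m_i > s_i`, every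
`f ∈ F^{s_0}_{p_0,q_0}(I, w_{γ_0}; X)` satisfies
`[f]^{(m_1)}_{F^{s_1}_{p_1,q_1}(I,w_{γ_1};X)} ≲ [f]^{(m_0)}_{F^{s_0}_{p_0,q_0}(I,w_{γ_0};X)}`
for `I ∈ {ℝ, ℝ_+}`. -/
theorem sobolev_embedding_seminorm
    (p0 p1 s0 s1 γ0 γ1 : ℝ) (q0 q1 : ℝ≥0∞) (m0 m1 : ℕ)
    (hp0 : 1 < p0) (hpp : p0 ≤ p1) (hq0 : 1 ≤ q0) (hq1 : 1 ≤ q1)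
    (hs1 : 0 < s1) (hs01 : s1 < s0)
    (hγ0 : γ0 ∈ Ioo (-1 : ℝ) (p0 - 1)) (hγ1 : γ1 ∈ Ioo (-1 : ℝ) (p1 - 1))
    (hw : γ1 / p1 ≤ γ0 / p0)
    (hsob : s0 - (1 + γ0) / p0 = s1 - (1 + γ1) / p1)
    (hm0 : s0 < m0) (hm1 : s1 < m1)
    (I : Set ℝ) (hI : I = univ ∨ I = Ioi (0:ℝ)) :
    ∃ C : ℝ≥0∞, C ≠ ⊤ ∧ ∀ f : ℝ → X,
      AEStronglyMeasurable f (volume.restrict I) → wLpNorm I p0 γ0 f < ⊤ →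
        diffSeminorm I s1 p1 γ1 q1 m1 f ≤ C * diffSeminorm I s0 p0 γ0 q0 m0 f := by
  exact final p0 p1 s0 s1 γ0 γ1 q0 q1 m0 m1 hp0 hpp hq0 hq1 hs1 hs01 hγ0 hγ1 hw hsob hm0 hm1 I hI
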